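/- Let P = P(d) be the natural unit interval order on {1,…,n} of a Dyck path d with bounce number 3. For every integer l with 0 ≤ l ≤ min{a,b,c}, the polynomial B_{3^l 2^1 1^{n-3l-2}}(q) − B_{3^l 2^2 1^{n-3l-4}}(q) + B_{3^{l+1} 2^1 1^{n-3l-5}}(q) − B_{3^{l+1} 1^{n-3l-3}}(q), which is the coefficient of e_{(n-2l-1,l+1,l)} in the elementary symmetric function expansion of the chromatic quasisymmetric function X_{inc(P)}(x,q), has nonnegative integer coefficients, i.e., lies in ℕ[q]. -/

import Mathlib

open scoped Classical

/-- A Dyck path on an `n × n` board: a weakly increasing sequence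
`d 1 ≤ d 2 ≤ ⋯ ≤ d (n-1) ≤ n` with `i ≤ d i`; we record it on indices `1, …, n`
with the harmless boundary convention `d n = n`. -/
structure DyckPath (n : ℕ) where
  d : ℕ → ℕ
  mono : ∀ i j : ℕ, 1 ≤ i → i ≤ j → j ≤ n → d i ≤ d j
  le_n : ∀ i : ℕ, 1 ≤ i → i ≤ n → d i ≤ n
  ge_self : ∀ i : ℕ, 1 ≤ i → i ≤ n → i ≤ d i
  top : d n = n

/-- The shape `3^l 2^j 1^m`, as a list of row lengths. -/
def shape (l j m : ℕ) : List ℕ :=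
  List.replicate l 3 ++ List.replicate j 2 ++ List.replicate m 1

/-- Position in the row-by-row reading word where row `i` (0-indexed) starts. -/
def rowStart (μ : List ℕ) (i : ℕ) : ℕ := (μ.take i).sum

/-- The entry in row `i`, column `j` (both 0-indexed) of the tableau of shape `μ`
whose row-by-row reading word is `L`. -/
def entry (μ L : List ℕ) (i j : ℕ) : ℕ := L.getD (rowStart μ i + j) 0

/-- The cells (row, column), 0-indexed, of the Young diagram with row lengths `μ`. -/
def cellsOf (μ : List ℕ) : Finset (ℕ × ℕ) :=
  (Finset.range μ.length ×ˢ Finset.range (μ.foldr max 0)).filter fun c =>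
    c.2 < μ.getD c.1 0

namespace DyckPath

variable {n : ℕ}

/-- The natural unit interval order `P(d)`: `i ≺ j ↔ i < n ∧ j > d i`. -/
def prec (D : DyckPath n) (i j : ℕ) : Prop := i < n ∧ D.d i < j

/-- Incomparability in `P(d)`. -/
def Incomp (D : DyckPath n) (x y : ℕ) : Prop := ¬ D.prec x y ∧ ¬ D.prec y x

/-- The bounce sequence `m 0 = d 1`, `m (k+1) = d (m k + 1)`. -/
def bounce (D : DyckPath n) : ℕ → ℕ
  | 0 => D.d 1
  | k + 1 => D.d (D.bounce k + 1)

def m0 (D : DyckPath n) : ℕ := D.bounce 0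

def m1 (D : DyckPath n) : ℕ := D.bounce 1

/-- `d` has bounce number three: `m 2 = n` is the first bounce term equal to `n`. -/
def BounceThree (D : DyckPath n) : Prop := D.m0 < n ∧ D.m1 < n ∧ D.bounce 2 = n

/-- `L` is the row-by-row reading word of a `P`-tableau of shape `μ`:
`L` uses each of `1, …, n` exactly once, rows strictly increase in `≺`, and for
vertically adjacent cells the lower entry is not `≺` the upper one. -/
def IsPTab (D : DyckPath n) (μ L : List ℕ) : Prop :=
  L.Perm (List.map (· + 1) (List.range n)) ∧ μ.sum = n ∧
  (∀ i j : ℕ, i < μ.length → j + 1 < μ.getD i 0 →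
    D.prec (entry μ L i j) (entry μ L i (j + 1))) ∧
  (∀ i j : ℕ, i + 1 < μ.length → j < μ.getD (i + 1) 0 →
    ¬ D.prec (entry μ L (i + 1) j) (entry μ L i j))

/-- The number of inversions of a `P`-tableau: pairs of entries `x > y`,
incomparable in `P`, with `x` in a strictly higher row than `y`. -/
noncomputable def invNum (D : DyckPath n) (μ L : List ℕ) : ℕ :=
  ((cellsOf μ ×ˢ cellsOf μ).filter fun pq =>
    pq.1.1 < pq.2.1 ∧ entry μ L pq.2.1 pq.2.2 < entry μ L pq.1.1 pq.1.2 ∧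
      D.Incomp (entry μ L pq.1.1 pq.1.2) (entry μ L pq.2.1 pq.2.2)).card

/-- The finite set of (reading words of) `P`-tableaux of shape `μ`. -/
noncomputable def ptabs (D : DyckPath n) (μ : List ℕ) : Finset (List ℕ) :=
  ((List.map (· + 1) (List.range n)).permutations.toFinset).filter fun L => D.IsPTab μ L

/-- `B_μ(q) = Σ_T q^{inv T}` over all `P`-tableaux `T` of shape `μ`, as a polynomial in `ℤ[q]`. -/
noncomputable def B (D : DyckPath n) (μ : List ℕ) : Polynomial ℤ :=
  ∑ L ∈ D.ptabs μ, Polynomial.X ^ D.invNum μ L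

end DyckPath

/-- A strict order `r` on a finite set `A` of naturals behaving like a natural unit interval order
without four-element chains. -/
structure IsShortUIO (A : Finset ℕ) (r : ℕ → ℕ → Prop) : Prop where
  mem_left : ∀ {x y}, r x y → x ∈ A
  mem_right : ∀ {x y}, r x y → y ∈ A
  lt : ∀ {x y}, r x y → x < y
  left : ∀ {x x' y}, r x' y → x ∈ A → x ≤ x' → r x y
  right : ∀ {x y y'}, r x y → y' ∈ A → y ≤ y' → r x y'
  no_four : ∀ {w x y z}, r w x → r x y → r y z → False

namespace IsShortUIO

open Polynomial

variable {A : Finset ℕ} {r : ℕ → ℕ → Prop}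

theorem trans (H : IsShortUIO A r) {x y z : ℕ} (h : r x y) (h' : r y z) : r x z :=
  H.left h' (H.mem_left h) (H.lt h).le

/-- The number of `b ∈ S` below `a` and `r`-incomparable to `a`. -/
noncomputable def invCount (r : ℕ → ℕ → Prop) (a : ℕ) (S : Finset ℕ) : ℕ :=
  (S.filter fun b => b < a ∧ ¬ r a b ∧ ¬ r b a).card

/-- The operator prepending the letter `a`, on functions of sets of letters. -/
noncomputable def u (r : ℕ → ℕ → Prop) (a : ℕ) :
    Module.End ℤ[X] (Finset ℕ → ℤ[X]) where
  toFun f S := if a ∈ S then X ^ invCount r a (S.erase a) * f (S.erase a) else 0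
  map_add' f g := by
    ext1 S
    by_cases h : a ∈ S <;> simp [h, mul_add]
  map_smul' c f := by
    ext1 S
    by_cases h : a ∈ S <;> simp [h, mul_left_comm]

theorem u_apply (a : ℕ) (f : Finset ℕ → ℤ[X]) (S : Finset ℕ) :
    u r a f S = if a ∈ S then X ^ invCount r a (S.erase a) * f (S.erase a) else 0 := rfl

theorem invCount_eq_erase {a b : ℕ} {S : Finset ℕ} (hb : b ∈ S) :
    invCount r a S =
      (if b < a ∧ ¬ r a b ∧ ¬ r b a then 1 else 0) + invCount r a (S.erase b) := by
  unfold invCount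
  rw [Finset.filter_erase]
  split_ifs with h
  · rw [Finset.card_erase_of_mem (by simp [hb, h])]
    have : 0 < (S.filter fun b => b < a ∧ ¬ r a b ∧ ¬ r b a).card :=
      Finset.card_pos.2 ⟨b, by simp [hb, h]⟩
    omega
  · rw [Finset.erase_eq_of_notMem (by simp [h]), zero_add]

theorem u_mul_u_apply {a b : ℕ} (hab : a ≠ b) (f : Finset ℕ → ℤ[X]) (S : Finset ℕ) :
    (u r a * u r b) f S = if a ∈ S ∧ b ∈ S then
      X ^ (if b < a ∧ ¬ r a b ∧ ¬ r b a then 1 else 0) *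
        (X ^ (invCount r a ((S.erase a).erase b) + invCount r b ((S.erase a).erase b)) *
          f ((S.erase a).erase b)) else 0 := by
  rw [Module.End.mul_apply, u_apply]
  by_cases ha : a ∈ S <;> by_cases hb : b ∈ S
  · rw [u_apply, invCount_eq_erase (b := b) (by simp [hb, hab.symm])]
    simp [ha, hb, hab.symm, pow_add, mul_assoc]
  all_goals simp [ha, hb, u_apply]

theorem u_comm (H : IsShortUIO A r) {a b : ℕ} (h : r a b) : Commute (u r a) (u r b) := by
  have hab := (H.lt h)
  refine LinearMap.ext fun f => funext fun S => ?_
  rw [u_mul_u_apply hab.ne, u_mul_u_apply hab.ne', Finset.erase_right_comm (a := b)]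
  simp [h, and_comm, add_comm]

theorem u_swap {a b : ℕ} (hab : a < b) (h : ¬ r a b) (h' : ¬ r b a) :
    u r b * u r a = (X : ℤ[X]) • (u r a * u r b) := by
  refine LinearMap.ext fun f => funext fun S => ?_
  rw [LinearMap.smul_apply, Pi.smul_apply, u_mul_u_apply hab.ne, u_mul_u_apply hab.ne',
    Finset.erase_right_comm (a := b)]
  simp [h, h', and_comm, add_comm, hab, hab.not_gt]

/-- Sum of the one-letter words. -/
noncomputable def e1 (A : Finset ℕ) (r : ℕ → ℕ → Prop) : Module.End ℤ[X] (Finset ℕ → ℤ[X]) :=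
  ∑ a ∈ A, u r a

/-- The two-element chains. -/
noncomputable def chain2 (A : Finset ℕ) (r : ℕ → ℕ → Prop) : Finset (ℕ × ℕ) :=
  (A ×ˢ A).filter fun p => r p.1 p.2

/-- The three-element chains. -/
noncomputable def chain3 (A : Finset ℕ) (r : ℕ → ℕ → Prop) : Finset (ℕ × ℕ × ℕ) :=
  (A ×ˢ A ×ˢ A).filter fun p => r p.1 p.2.1 ∧ r p.2.1 p.2.2

/-- Sum of the words of two-element chains. -/
noncomputable def e2 (A : Finset ℕ) (r : ℕ → ℕ → Prop) : Module.End ℤ[X] (Finset ℕ → ℤ[X]) :=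
  ∑ p ∈ chain2 A r, u r p.1 * u r p.2

/-- Sum of the words of three-element chains. -/
noncomputable def e3 (A : Finset ℕ) (r : ℕ → ℕ → Prop) : Module.End ℤ[X] (Finset ℕ → ℤ[X]) :=
  ∑ p ∈ chain3 A r, u r p.1 * (u r p.2.1 * u r p.2.2)

theorem mem_chain2 (H : IsShortUIO A r) {x y : ℕ} : (x, y) ∈ chain2 A r ↔ r x y := by
  simp only [chain2, Finset.mem_filter, Finset.mem_product]
  exact ⟨fun h => h.2, fun h => ⟨⟨H.mem_left h, H.mem_right h⟩, h⟩⟩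

theorem mem_chain3 (H : IsShortUIO A r) {x y z : ℕ} :
    (x, y, z) ∈ chain3 A r ↔ r x y ∧ r y z := by
  simp only [chain3, Finset.mem_filter, Finset.mem_product]
  exact ⟨fun h => h.2, fun h => ⟨⟨H.mem_left h.1, H.mem_left h.2, H.mem_right h.2⟩, h⟩⟩

/-- An element incomparable to both ends of a two-element chain lies between them. -/
theorem between (H : IsShortUIO A r) {x y c : ℕ} (h : r x y) (hc : c ∈ A)
    (hx : ¬ r x c) (hy : ¬ r c y) : x < c ∧ c < y := by
  constructor
  · by_contra hlt
    exact hy (H.left h hc (not_lt.1 hlt))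
  · by_contra hlt
    exact hx (H.right h hc (not_lt.1 hlt))

theorem u_mul_chain (H : IsShortUIO A r) {x y c : ℕ} (h : r x y) (hc : c ∈ A)
    (h1 : ¬ r x c) (h2 : ¬ r c x) (h3 : ¬ r y c) (h4 : ¬ r c y) :
    u r c * (u r x * u r y) = u r x * u r y * u r c := by
  obtain ⟨hx, hy⟩ := H.between h hc h1 h4
  rw [← mul_assoc, u_swap hx h1 h2, mul_assoc (u r x), u_swap hy h4 h3]
  simp [mul_assoc]

theorem e1_comm_e2 (H : IsShortUIO A r) : Commute (e1 A r) (e2 A r) := by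
  unfold Commute SemiconjBy e1 e2
  rw [Finset.sum_mul_sum, Finset.sum_mul_sum, ← Finset.sum_product', ← Finset.sum_product']
  refine Finset.sum_nbij'
    (fun t => if r t.1 t.2.2 ∧ ¬ r t.1 t.2.1 ∧ ¬ r t.2.1 t.1 then ((t.1, t.2.2), t.2.1)
      else if r t.2.1 t.1 ∧ ¬ r t.1 t.2.2 ∧ ¬ r t.2.2 t.1 then ((t.2.1, t.1), t.2.2)
      else (t.2, t.1))
    (fun t => if r t.2 t.1.2 ∧ ¬ r t.2 t.1.1 ∧ ¬ r t.1.1 t.2 then (t.1.1, (t.2, t.1.2))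
      else if r t.1.1 t.2 ∧ ¬ r t.2 t.1.2 ∧ ¬ r t.1.2 t.2 then (t.1.2, (t.1.1, t.2))
      else (t.2, t.1)) ?_ ?_ ?_ ?_ ?_
  · rintro ⟨c, x, y⟩ h
    rw [Finset.mem_product, H.mem_chain2] at h
    have := H.mem_left h.2
    have := H.mem_right h.2
    dsimp only at h ⊢
    split_ifs <;> simp_all [H.mem_chain2]
  · rintro ⟨⟨x, y⟩, c⟩ h
    rw [Finset.mem_product, H.mem_chain2] at h
    have := H.mem_left h.1
    have := H.mem_right h.1
    dsimp only at h ⊢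
    split_ifs <;> simp_all [H.mem_chain2]
  · rintro ⟨c, x, y⟩ h
    rw [Finset.mem_product, H.mem_chain2] at h
    grind
  · rintro ⟨⟨x, y⟩, c⟩ h
    rw [Finset.mem_product, H.mem_chain2] at h
    grind
  · rintro ⟨c, x, y⟩ h
    rw [Finset.mem_product, H.mem_chain2] at h
    obtain ⟨hc, h⟩ := h
    dsimp only at hc h ⊢
    split_ifs with h1 h2
    · simp only
      rw [mul_assoc, (H.u_comm h).eq]
    · simp only
      rw [← mul_assoc, (H.u_comm h2.1).eq]
    · simp only
      by_cases hxc : r x c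
      · by_cases hyc : r y c
        · exact ((H.u_comm hxc).mul_left (H.u_comm hyc)).symm
        by_cases hcy : r c y
        · exact ((H.u_comm hxc).mul_left (H.u_comm hcy).symm).symm
        · exact absurd ⟨hxc, hcy, hyc⟩ h2
      · by_cases hcx : r c x
        · exact (H.u_comm hcx).mul_right (H.u_comm (H.trans hcx h))
        · have hcy : ¬ r c y := fun hh => h1 ⟨hh, hcx, hxc⟩
          exact H.u_mul_chain h hc hxc hcx (fun hh => hxc (H.trans h hh)) hcy

theorem e1_comm_e3 (H : IsShortUIO A r) : Commute (e1 A r) (e3 A r) := by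
  unfold Commute SemiconjBy e1 e3
  rw [Finset.sum_mul_sum, Finset.sum_mul_sum, ← Finset.sum_product', ← Finset.sum_product']
  refine Finset.sum_nbij'
    (fun t => if r t.1 t.2.2.1 ∧ ¬ r t.1 t.2.1 ∧ ¬ r t.2.1 t.1 then
        ((t.1, t.2.2.1, t.2.2.2), t.2.1)
      else if r t.2.1 t.1 ∧ r t.1 t.2.2.2 ∧ ¬ r t.1 t.2.2.1 ∧ ¬ r t.2.2.1 t.1 then
        ((t.2.1, t.1, t.2.2.2), t.2.2.1)
      else if r t.2.2.1 t.1 ∧ ¬ r t.1 t.2.2.2 ∧ ¬ r t.2.2.2 t.1 then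
        ((t.2.1, t.2.2.1, t.1), t.2.2.2)
      else (t.2, t.1))
    (fun t => if r t.2 t.1.2.1 ∧ ¬ r t.2 t.1.1 ∧ ¬ r t.1.1 t.2 then
        (t.1.1, (t.2, t.1.2.1, t.1.2.2))
      else if r t.1.1 t.2 ∧ r t.2 t.1.2.2 ∧ ¬ r t.2 t.1.2.1 ∧ ¬ r t.1.2.1 t.2 then
        (t.1.2.1, (t.1.1, t.2, t.1.2.2))
      else if r t.1.2.1 t.2 ∧ ¬ r t.2 t.1.2.2 ∧ ¬ r t.1.2.2 t.2 then
        (t.1.2.2, (t.1.1, t.1.2.1, t.2))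
      else (t.2, t.1)) ?_ ?_ ?_ ?_ ?_
  · rintro ⟨c, x, y, z⟩ h
    rw [Finset.mem_product, H.mem_chain3] at h
    have := H.mem_left h.2.1
    have := H.mem_left h.2.2
    have := H.mem_right h.2.2
    dsimp only at h ⊢
    split_ifs <;> simp_all [H.mem_chain3]
  · rintro ⟨⟨x, y, z⟩, c⟩ h
    rw [Finset.mem_product, H.mem_chain3] at h
    have := H.mem_left h.1.1
    have := H.mem_left h.1.2
    have := H.mem_right h.1.2
    dsimp only at h ⊢
    split_ifs <;> simp_all [H.mem_chain3]
  · rintro ⟨c, x, y, z⟩ h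
    rw [Finset.mem_product, H.mem_chain3] at h
    obtain ⟨hc, h, h'⟩ := h
    have := H.trans h h'
    have := H.lt h
    have := H.lt h'
    have : ∀ {x y z}, r x y → r y z → r x z := H.trans
    have : ∀ x, ¬ r x x := fun x h => (H.lt h).false
    dsimp only at hc h h' ⊢
    grind
  · rintro ⟨⟨x, y, z⟩, c⟩ h
    rw [Finset.mem_product, H.mem_chain3] at h
    obtain ⟨⟨h, h'⟩, hc⟩ := h
    have := H.trans h h'
    have : ∀ {x y z}, r x y → r y z → r x z := H.trans
    have : ∀ x, ¬ r x x := fun x h => (H.lt h).false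
    dsimp only at hc h h' ⊢
    grind
  · rintro ⟨c, x, y, z⟩ h
    rw [Finset.mem_product, H.mem_chain3] at h
    obtain ⟨hc, h, h'⟩ := h
    dsimp only at hc h h' ⊢
    have hxz := H.trans h h'
    split_ifs with h1 h2 h3
    · simp only
      rw [mul_assoc, ((H.u_comm h).mul_right (H.u_comm hxz)).eq]
    · simp only
      rw [← mul_assoc, (H.u_comm h2.1).symm.eq, (H.u_comm h').eq]
      simp only [mul_assoc]
    · simp only
      have hxc := H.trans h h3.1
      rw [← mul_assoc, (H.u_comm hxc).symm.eq, mul_assoc, ← mul_assoc (u r c),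
        (H.u_comm h3.1).symm.eq]
      simp only [mul_assoc]
    · simp only
      by_cases hxc : r x c
      · have hcy : ¬ r c y := fun hh => H.no_four hxc hh h'
        have hyc : ¬ r y c := fun hh => by
          by_cases hzc : r z c
          · exact H.no_four h h' hzc
          · exact h3 ⟨hh, fun hcz => H.no_four h hh hcz, hzc⟩
        have hcz : ¬ r c z := fun hh => h2 ⟨hxc, hh, hcy, hyc⟩
        have hzc : ¬ r z c := fun hh => H.no_four h h' hh
        rw [← mul_assoc, (H.u_comm hxc).symm.eq, mul_assoc,
          H.u_mul_chain h' hc hyc hcy hzc hcz]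
        simp only [mul_assoc]
      · have hcx : ¬ r c x := fun hh => H.no_four hh h h'
        have hcy : ¬ r c y := fun hh => h1 ⟨hh, hcx, hxc⟩
        have hyc : ¬ r y c := fun hh => hxc (H.trans h hh)
        have hcz : r c z := H.left h' hc (H.between h hc hxc hcy).2.le
        rw [← mul_assoc (u r x), ← mul_assoc, H.u_mul_chain h hc hxc hcx hyc hcy, mul_assoc,
          (H.u_comm hcz).eq]
        simp only [mul_assoc]

/-- Two stacked two-element chains violating a column condition. -/
noncomputable def bad22 (A : Finset ℕ) (r : ℕ → ℕ → Prop) : Finset ((ℕ × ℕ) × (ℕ × ℕ)) :=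
  (chain2 A r ×ˢ chain2 A r).filter fun t => r t.2.1 t.1.1 ∨ r t.2.2 t.1.2

theorem sum_bad22 (H : IsShortUIO A r) :
    ∑ t ∈ bad22 A r, u r t.1.1 * u r t.1.2 * (u r t.2.1 * u r t.2.2) = e3 A r * e1 A r := by
  unfold e1 e3
  rw [Finset.sum_mul_sum, ← Finset.sum_product']
  refine Finset.sum_nbij'
    (fun t => if r t.2.1 t.1.1 then ((t.2.1, t.1.1, t.1.2), t.2.2)
      else if r t.1.1 t.2.2 then ((t.1.1, t.2.2, t.1.2), t.2.1)
      else ((t.2.1, t.2.2, t.1.2), t.1.1))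
    (fun t => if r t.1.1 t.2 then ((t.1.2.1, t.1.2.2), (t.1.1, t.2))
      else if r t.2 t.1.2.1 then ((t.1.1, t.1.2.2), (t.2, t.1.2.1))
      else ((t.2, t.1.2.2), (t.1.1, t.1.2.1))) ?_ ?_ ?_ ?_ ?_
  · rintro ⟨⟨x, y⟩, ⟨x', y'⟩⟩ h
    rw [bad22, Finset.mem_filter, Finset.mem_product, H.mem_chain2, H.mem_chain2] at h
    obtain ⟨⟨h, h'⟩, hb⟩ := h
    have := H.mem_left h
    have := H.mem_left h'
    have := H.mem_right h'
    dsimp only at h h' hb ⊢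
    split_ifs <;> simp_all [H.mem_chain3]
  · rintro ⟨⟨a, b, c⟩, t⟩ h
    rw [Finset.mem_product, H.mem_chain3] at h
    obtain ⟨⟨h, h'⟩, ht⟩ := h
    dsimp only at h h' ht ⊢
    split_ifs with h1 h2
    · simp_all [bad22, H.mem_chain2]
    · simp_all [bad22, H.mem_chain2, H.trans h h']
    · have : r t c := H.left h' ht (H.between h ht h1 h2).2.le
      simp_all [bad22, H.mem_chain2]
  · rintro ⟨⟨x, y⟩, ⟨x', y'⟩⟩ h
    rw [bad22, Finset.mem_filter, Finset.mem_product, H.mem_chain2, H.mem_chain2] at h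
    obtain ⟨⟨h, h'⟩, hb⟩ := h
    dsimp only at h h' hb ⊢
    have : ¬ r x x' ∨ ¬ r y' y := by
      by_contra hh
      push Not at hh
      exact H.no_four hh.1 h' hh.2
    grind
  · rintro ⟨⟨a, b, c⟩, t⟩ h
    rw [Finset.mem_product, H.mem_chain3] at h
    obtain ⟨⟨h, h'⟩, ht⟩ := h
    dsimp only at h h' ht ⊢
    have : ¬ r t a := fun hh => H.no_four hh h h'
    grind
  · rintro ⟨⟨x, y⟩, ⟨x', y'⟩⟩ h
    rw [bad22, Finset.mem_filter, Finset.mem_product, H.mem_chain2, H.mem_chain2] at h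
    obtain ⟨⟨h, h'⟩, hb⟩ := h
    dsimp only at h h' hb ⊢
    split_ifs with h1 h2
    · simp only
      rw [← mul_assoc, ← ((H.u_comm h1).mul_right (H.u_comm (H.trans h1 h))).eq]
    · simp only
      have hb : r y' y := by tauto
      rw [(H.u_comm h').eq, mul_assoc, ← mul_assoc (u r y), ← (H.u_comm hb).eq, mul_assoc,
        ← (H.u_comm (H.trans h' hb)).eq]
      simp only [mul_assoc]
      rw [(H.u_comm (H.trans h' hb)).eq]
    · simp only
      have hb : r y' y := by tauto
      have e : u r y * (u r x' * u r y') = u r x' * u r y' * u r y :=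
        ((H.u_comm (H.trans h' hb)).symm.mul_right (H.u_comm hb).symm).eq
      have h3 : ¬ r x x' := fun hh => h2 (H.trans hh h')
      have h4 : ¬ r y' x := fun hh => h1 (H.trans h' hh)
      rw [mul_assoc, e, ← mul_assoc, H.u_mul_chain h' (H.mem_left h) h1 h3 h4 h2, mul_assoc,
        (H.u_comm h).eq]
      simp only [mul_assoc]

/-- The words of length `m` in the alphabet `A`. -/
noncomputable def words (A : Finset ℕ) : ℕ → Finset (List ℕ)
  | 0 => {[]}
  | m + 1 => (A ×ˢ words A m).image fun p => p.1 :: p.2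

theorem mem_words {m : ℕ} {L : List ℕ} : L ∈ words A m ↔ L.length = m ∧ ∀ x ∈ L, x ∈ A := by
  induction m generalizing L with
  | zero => cases L <;> simp [words]
  | succ m ih => cases L <;> simp [words, ih]; tauto

theorem sum_words_succ {M : Type*} [AddCommMonoid M] (m : ℕ) (f : List ℕ → M) :
    ∑ L ∈ words A (m + 1), f L = ∑ a ∈ A, ∑ w ∈ words A m, f (a :: w) := by
  rw [words, Finset.sum_image (by rintro ⟨a, v⟩ _ ⟨b, w⟩ _ h; simpa using h), Finset.sum_product]

/-- The operator of a word. -/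
noncomputable def U (r : ℕ → ℕ → Prop) (L : List ℕ) : Module.End ℤ[X] (Finset ℕ → ℤ[X]) :=
  (L.map (u r)).prod

@[simp] theorem U_nil : U r [] = 1 := rfl

@[simp] theorem U_cons (a : ℕ) (L : List ℕ) : U r (a :: L) = u r a * U r L := by simp [U]

@[simp] theorem U_append (L L' : List ℕ) : U r (L ++ L') = U r L * U r L' := by simp [U]

theorem u_comm_U (H : IsShortUIO A r) {y : ℕ} {L : List ℕ} (h : ∀ x ∈ L, r x y) :
    Commute (u r y) (U r L) := by
  induction L with
  | nil => exact Commute.one_right _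
  | cons a L ih =>
    rw [U_cons]
    exact (H.u_comm (h a (by simp))).symm.mul_right (ih fun x hx => h x (by simp [hx]))

/-- Words without descents for `r`. -/
def NoDesc (r : ℕ → ℕ → Prop) (L : List ℕ) : Prop := L.IsChain fun a b => ¬ r b a

/-- The descent-free words of length `m`. -/
noncomputable def ndWords (A : Finset ℕ) (r : ℕ → ℕ → Prop) (m : ℕ) : Finset (List ℕ) :=
  (words A m).filter (NoDesc r)

theorem mem_ndWords {m : ℕ} {L : List ℕ} :
    L ∈ ndWords A r m ↔ L.length = m ∧ (∀ x ∈ L, x ∈ A) ∧ NoDesc r L := by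
  rw [ndWords, Finset.mem_filter, mem_words, and_assoc]

theorem noDesc_cons {a : ℕ} {L : List ℕ} :
    NoDesc r (a :: L) ↔ (∀ y ∈ L.head?, ¬ r y a) ∧ NoDesc r L := List.isChain_cons

/-- Sum of the descent-free words of length `m`. -/
noncomputable def h (A : Finset ℕ) (r : ℕ → ℕ → Prop) (m : ℕ) :
    Module.End ℤ[X] (Finset ℕ → ℤ[X]) :=
  ∑ L ∈ ndWords A r m, U r L

theorem h_zero : h A r 0 = 1 := by
  simp [h, ndWords, words, Finset.filter_singleton, NoDesc]

/-- Index set of tableaux of shape `2 1^m`. -/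
noncomputable def hookWords (A : Finset ℕ) (r : ℕ → ℕ → Prop) (m : ℕ) :
    Finset ((ℕ × ℕ) × List ℕ) :=
  (chain2 A r ×ˢ words A m).filter fun t => NoDesc r (t.1.1 :: t.2)

theorem mem_hookWords (H : IsShortUIO A r) {m x y : ℕ} {v : List ℕ} :
    ((x, y), v) ∈ hookWords A r m ↔
      r x y ∧ v.length = m ∧ (∀ t ∈ v, t ∈ A) ∧ NoDesc r (x :: v) := by
  rw [hookWords, Finset.mem_filter, Finset.mem_product, H.mem_chain2, mem_words]
  tauto

/-- Sum of the tableaux of shape `2 1^m`. -/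
noncomputable def hook (A : Finset ℕ) (r : ℕ → ℕ → Prop) (m : ℕ) :
    Module.End ℤ[X] (Finset ℕ → ℤ[X]) :=
  ∑ t ∈ hookWords A r m, u r t.1.1 * u r t.1.2 * U r t.2

theorem hook_zero : hook A r 0 = e2 A r := by
  rw [hook, e2, hookWords, words, Finset.sum_filter, Finset.sum_product]
  simp [NoDesc]

theorem hook_succ (H : IsShortUIO A r) (m : ℕ) :
    hook A r (m + 1) = e2 A r * h A r (m + 1) - e3 A r * h A r m := by
  rw [eq_sub_iff_add_eq]
  unfold hook e2 e3 h
  rw [Finset.sum_mul_sum, Finset.sum_mul_sum, ← Finset.sum_product', ← Finset.sum_product',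
    ← Finset.sum_filter_add_sum_filter_not (chain2 A r ×ˢ ndWords A r (m + 1))
      (fun t => NoDesc r (t.1.1 :: t.2))]
  congr 1
  · refine Finset.sum_congr ?_ fun _ _ => rfl
    ext ⟨⟨x, y⟩, v⟩
    simp only [H.mem_hookWords, Finset.mem_filter, Finset.mem_product, mem_ndWords, H.mem_chain2,
      noDesc_cons]
    tauto
  · symm
    refine Finset.sum_nbij' (fun t => ((t.2.headD 0, t.1), t.2.tail))
      (fun t => (t.1.2, t.1.1 :: t.2)) ?_ ?_ ?_ ?_ ?_
    · rintro ⟨⟨x, y⟩, _ | ⟨t, v⟩⟩ hm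
      · simp [mem_ndWords] at hm
      simp only [Finset.mem_filter, Finset.mem_product, mem_ndWords, H.mem_chain2, H.mem_chain3,
        noDesc_cons] at hm ⊢
      simp_all
      tauto
    · rintro ⟨⟨t, x, y⟩, v⟩ hm
      simp only [Finset.mem_filter, Finset.mem_product, mem_ndWords, H.mem_chain2, H.mem_chain3,
        noDesc_cons] at hm ⊢
      obtain ⟨⟨h1, h2⟩, h3, h4, h5⟩ := hm
      have := H.mem_left h1
      have : ∀ z ∈ v.head?, ¬ r z t := fun z _ hz => H.no_four hz h1 h2
      simp_all
    · rintro ⟨⟨x, y⟩, _ | ⟨t, v⟩⟩ hm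
      · simp [mem_ndWords] at hm
      rfl
    · rintro ⟨⟨t, x, y⟩, v⟩ hm
      rfl
    · rintro ⟨⟨x, y⟩, _ | ⟨t, v⟩⟩ hm
      · simp [mem_ndWords] at hm
      simp only [Finset.mem_filter, Finset.mem_product, mem_ndWords, H.mem_chain2,
        noDesc_cons] at hm
      obtain ⟨⟨h1, h2⟩, h3⟩ := hm
      have h4 : r t x := by
        by_contra h4
        simp_all
      simp only [U_cons, List.headD_cons, List.tail_cons]
      rw [← mul_assoc, ← ((H.u_comm h4).mul_right (H.u_comm (H.trans h4 h1))).eq]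

/-- A letter together with a descent-free word whose first letter lies below it. -/
noncomputable def descPairs (A : Finset ℕ) (r : ℕ → ℕ → Prop) (m : ℕ) : Finset (ℕ × List ℕ) :=
  (A ×ˢ ndWords A r m).filter fun t => ∃ x ∈ t.2.head?, r x t.1

theorem mem_descPairs {m y : ℕ} {v : List ℕ} :
    (y, v) ∈ descPairs A r m ↔ y ∈ A ∧ v ∈ ndWords A r m ∧ ∃ x ∈ v.head?, r x y := by
  rw [descPairs, Finset.mem_filter, Finset.mem_product, and_assoc]

theorem descPairs_zero : descPairs A r 0 = ∅ := by
  ext ⟨y, v⟩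
  simp only [mem_descPairs, mem_ndWords]
  constructor
  · rintro ⟨-, ⟨h1, -⟩, h2⟩
    simp_all [List.length_eq_zero_iff]
  · simp

theorem sum_descPairs_succ (H : IsShortUIO A r) (m : ℕ) :
    ∑ t ∈ descPairs A r (m + 1), u r t.1 * U r t.2 = hook A r m := by
  unfold hook
  refine Finset.sum_nbij' (fun t => ((t.2.headD 0, t.1), t.2.tail))
      (fun t => (t.1.2, t.1.1 :: t.2)) ?_ ?_ ?_ ?_ ?_
  · rintro ⟨y, _ | ⟨x, v⟩⟩ hm
    · simp [mem_descPairs] at hm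
    · simp only [mem_descPairs, mem_ndWords, H.mem_hookWords] at hm ⊢
      simp_all
  · rintro ⟨⟨x, y⟩, v⟩ hm
    simp only [mem_descPairs, mem_ndWords, H.mem_hookWords] at hm ⊢
    have := H.mem_left hm.1
    have := H.mem_right hm.1
    simp_all
  · rintro ⟨y, _ | ⟨x, v⟩⟩ hm
    · simp [mem_descPairs] at hm
    · rfl
  · rintro ⟨⟨x, y⟩, v⟩ hm
    rfl
  · rintro ⟨y, _ | ⟨x, v⟩⟩ hm
    · simp [mem_descPairs] at hm
    · simp only [mem_descPairs] at hm
      have : r x y := by simpa using hm.2.2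
      simp only [U_cons, List.headD_cons, List.tail_cons]
      rw [← mul_assoc, (H.u_comm this).eq]

theorem h_succ_eq (m : ℕ) :
    h A r (m + 1) + ∑ t ∈ descPairs A r m, u r t.1 * U r t.2 = e1 A r * h A r m := by
  have e : h A r (m + 1) = ∑ t ∈ (A ×ˢ ndWords A r m).filter (fun t => ¬ ∃ x ∈ t.2.head?, r x t.1),
      u r t.1 * U r t.2 := by
    rw [h, ndWords, Finset.sum_filter, sum_words_succ, Finset.sum_filter, Finset.sum_product]
    refine Finset.sum_congr rfl fun a _ => ?_
    rw [ndWords, Finset.sum_filter]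
    refine Finset.sum_congr rfl fun w _ => ?_
    simp only [noDesc_cons, U_cons, not_exists, not_and]
    split_ifs <;> first | rfl | tauto
  rw [e, descPairs, add_comm, Finset.sum_filter_add_sum_filter_not, h, e1, Finset.sum_mul_sum,
    Finset.sum_product]

theorem h_one : h A r 1 = e1 A r := by
  have := h_succ_eq (A := A) (r := r) 0
  simpa [descPairs_zero, h_zero] using this

theorem h_succ_succ (H : IsShortUIO A r) (m : ℕ) :
    h A r (m + 2) = e1 A r * h A r (m + 1) - hook A r m := by
  rw [← h_succ_eq, H.sum_descPairs_succ]
  abel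

theorem e1_comm_h (H : IsShortUIO A r) (m : ℕ) : Commute (e1 A r) (h A r m) := by
  induction m using Nat.strong_induction_on with
  | _ m ih =>
    rcases m with _ | _ | m
    · rw [h_zero]
      exact Commute.one_right _
    · rw [h_one]
    · rw [H.h_succ_succ]
      refine ((Commute.refl _).mul_right (ih _ (by omega))).sub_right ?_
      rcases m with _ | m
      · rw [hook_zero]
        exact H.e1_comm_e2
      · rw [H.hook_succ]
        exact (H.e1_comm_e2.mul_right (ih _ (by omega))).sub_right
          (H.e1_comm_e3.mul_right (ih _ (by omega)))

/-- Sum of the tableaux of shape `2 2 1^m`. -/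
noncomputable def hook22 (A : Finset ℕ) (r : ℕ → ℕ → Prop) (m : ℕ) :
    Module.End ℤ[X] (Finset ℕ → ℤ[X]) :=
  ∑ t ∈ (chain2 A r ×ˢ hookWords A r m).filter
      (fun t => ¬ (r t.2.1.1 t.1.1 ∨ r t.2.1.2 t.1.2)),
    u r t.1.1 * u r t.1.2 * (u r t.2.1.1 * u r t.2.1.2 * U r t.2.2)

theorem hook22_eq (H : IsShortUIO A r) (m : ℕ) :
    hook22 A r m = e2 A r * hook A r m - e3 A r * e1 A r * h A r m := by
  rw [eq_sub_iff_add_eq, ← H.sum_bad22, e2, hook, Finset.sum_mul_sum, ← Finset.sum_product',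
    hook22, h, Finset.sum_mul_sum, ← Finset.sum_product', add_comm,
    ← Finset.sum_filter_add_sum_filter_not (chain2 A r ×ˢ hookWords A r m)
      (fun t => r t.2.1.1 t.1.1 ∨ r t.2.1.2 t.1.2)]
  congr 1
  refine Finset.sum_nbij' (fun t => (t.1.1, t.1.2, t.2)) (fun t => ((t.1, t.2.1), t.2.2))
    ?_ ?_ (fun _ _ => rfl) (fun _ _ => rfl) ?_
  · rintro ⟨⟨⟨x, y⟩, ⟨x', y'⟩⟩, v⟩ hm
    simp only [bad22, Finset.mem_filter, Finset.mem_product, H.mem_chain2, H.mem_hookWords,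
      mem_ndWords, noDesc_cons] at hm ⊢
    obtain ⟨⟨⟨h1, h2⟩, h3⟩, h4, h5, h6⟩ := hm
    refine ⟨⟨h1, h2, h4, h5, fun t _ ht => ?_, h6⟩, h3⟩
    rcases h3 with h3 | h3
    · exact H.no_four ht h3 h1
    · exact H.no_four ht h2 h3
  · rintro ⟨⟨x, y⟩, ⟨x', y'⟩, v⟩ hm
    simp only [bad22, Finset.mem_filter, Finset.mem_product, H.mem_chain2, H.mem_hookWords,
      mem_ndWords, noDesc_cons] at hm ⊢
    tauto
  · rintro ⟨⟨⟨x, y⟩, ⟨x', y'⟩⟩, v⟩ _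
    simp only [mul_assoc]

/-- `y` is a nontrivial left-to-right maximum of `w` for `r`. -/
def IsLRMax (r : ℕ → ℕ → Prop) (w : List ℕ) (y : ℕ) : Prop :=
  ∃ a b, w = a ++ y :: b ∧ a ≠ [] ∧ ∀ x ∈ a, r x y

/-- Insert `y` after the longest prefix of `v` lying below `y`. -/
noncomputable def ins (r : ℕ → ℕ → Prop) (y : ℕ) (v : List ℕ) : List ℕ :=
  v.takeWhile (fun x => r x y) ++ y :: v.dropWhile (fun x => r x y)

theorem ins_append {y : ℕ} {a b : List ℕ} (ha : ∀ x ∈ a, r x y) (hb : ∀ z ∈ b.head?, ¬ r z y) :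
    ins r y (a ++ b) = a ++ y :: b := by
  have hb1 : b.takeWhile (fun x => decide (r x y)) = [] := by
    cases b <;> simp_all
  have hb2 : b.dropWhile (fun x => decide (r x y)) = b := by
    cases b <;> simp_all
  rw [ins, List.takeWhile_append_of_pos (by simpa using ha),
    List.dropWhile_append_of_pos (by simpa using ha), hb1, hb2, List.append_nil]

theorem exists_prefix (r : ℕ → ℕ → Prop) (y : ℕ) (v : List ℕ) :
    ∃ a b, v = a ++ b ∧ (∀ x ∈ a, r x y) ∧ ∀ z ∈ b.head?, ¬ r z y := by
  refine ⟨v.takeWhile (fun x => r x y), v.dropWhile (fun x => r x y),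
    List.takeWhile_append_dropWhile.symm, fun x hx => by simpa using List.mem_takeWhile_imp hx,
    fun z hz => ?_⟩
  have := List.head?_dropWhile_not (fun x => decide (r x y)) v
  rw [Option.mem_def.1 hz] at this
  simpa using this

theorem noDesc_insert (H : IsShortUIO A r) {y : ℕ} {a b : List ℕ}
    (ha : ∀ x ∈ a, r x y) :
    NoDesc r (a ++ y :: b) ↔ NoDesc r (a ++ b) ∧ ∀ z ∈ b.head?, ¬ r z y := by
  unfold NoDesc
  simp only [List.isChain_append, List.isChain_cons]
  constructor
  · rintro ⟨h1, ⟨h2, h3⟩, h4⟩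
    refine ⟨⟨h1, h3, fun x hx z hz hzx => ?_⟩, h2⟩
    exact h2 z hz (H.trans hzx (ha x (List.mem_of_mem_getLast? hx)))
  · rintro ⟨⟨h1, h2, h3⟩, h4⟩
    refine ⟨h1, ⟨h4, h2⟩, fun x hx z hz hzx => ?_⟩
    obtain rfl : y = z := by simpa using hz
    exact (H.lt (ha x (List.mem_of_mem_getLast? hx))).not_gt (H.lt hzx)

/-- Words with a marked left-to-right maximum. -/
noncomputable def markedWords (A : Finset ℕ) (r : ℕ → ℕ → Prop) (m : ℕ) : Finset (ℕ × List ℕ) :=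
  (A ×ˢ ndWords A r m).filter fun t => IsLRMax r t.2 t.1

theorem sum_ins (H : IsShortUIO A r) {M : Type*} [AddCommMonoid M] (m : ℕ)
    (f : ℕ → List ℕ → M) :
    ∑ t ∈ descPairs A r m, f t.1 (ins r t.1 t.2) = ∑ t ∈ markedWords A r (m + 1), f t.1 t.2 := by
  have key : ∀ {y : ℕ} {a b : List ℕ}, (∀ x ∈ a, r x y) → (a ++ y :: b).erase y = a ++ b := by
    intro y a b ha
    rw [List.erase_append_right _ fun hy => (H.lt (ha y hy)).false, List.erase_cons_head]
  refine Finset.sum_nbij' (fun t => (t.1, ins r t.1 t.2)) (fun t => (t.1, t.2.erase t.1))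
    ?_ ?_ ?_ ?_ fun _ _ => rfl
  · rintro ⟨y, v⟩ hm
    obtain ⟨a, b, rfl, ha, hb⟩ := exists_prefix r y v
    simp only [mem_descPairs, mem_ndWords, markedWords, Finset.mem_filter, Finset.mem_product,
      ins_append ha hb] at hm ⊢
    obtain ⟨h1, ⟨h2, h3, h4⟩, x, hx, hxy⟩ := hm
    have h0 : a ≠ [] := by
      rintro rfl
      exact hb x (by simpa using hx) hxy
    refine ⟨⟨h1, ?_, ?_, (H.noDesc_insert ha).2 ⟨h4, hb⟩⟩, a, b, rfl, h0, ha⟩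
    · simp at h2 ⊢
      omega
    · intro z hz
      simp only [List.mem_append, List.mem_cons] at hz
      rcases hz with hz | rfl | hz
      · exact h3 z (by simp [hz])
      · exact h1
      · exact h3 z (by simp [hz])
  · rintro ⟨y, w⟩ hm
    simp only [mem_descPairs, mem_ndWords, markedWords, Finset.mem_filter, Finset.mem_product]
      at hm ⊢
    obtain ⟨⟨h1, h2, h3, h4⟩, a, b, rfl, h0, ha⟩ := hm
    rw [key ha]
    obtain ⟨h5, h6⟩ := (H.noDesc_insert ha).1 h4
    refine ⟨h1, ⟨?_, fun z hz => h3 z ?_, h5⟩, ?_⟩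
    · simp at h2 ⊢
      omega
    · simp only [List.mem_append, List.mem_cons] at hz ⊢
      tauto
    · obtain ⟨x, a, rfl⟩ := List.exists_cons_of_ne_nil h0
      exact ⟨x, by simp, ha x (by simp)⟩
  · rintro ⟨y, v⟩ hm
    obtain ⟨a, b, rfl, ha, hb⟩ := exists_prefix r y v
    simp only [ins_append ha hb, key ha]
  · rintro ⟨y, w⟩ hm
    simp only [mem_ndWords, markedWords, Finset.mem_filter, Finset.mem_product] at hm
    obtain ⟨⟨h1, h2, h3, h4⟩, a, b, rfl, h0, ha⟩ := hm
    simp only [key ha, ins_append ha ((H.noDesc_insert ha).1 h4).2]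

theorem U_ins (H : IsShortUIO A r) (y : ℕ) (v : List ℕ) : U r (ins r y v) = u r y * U r v := by
  obtain ⟨a, b, rfl, ha, hb⟩ := exists_prefix r y v
  rw [ins_append ha hb, U_append, U_append, U_cons, ← mul_assoc, ← (H.u_comm_U ha).eq, mul_assoc]

theorem IsLRMax.head {w : List ℕ} {x y : ℕ} (hy : IsLRMax r w y) (hx : x ∈ w.head?) : r x y := by
  obtain ⟨a, b, rfl, h0, ha⟩ := hy
  obtain ⟨t, a, rfl⟩ := List.exists_cons_of_ne_nil h0
  obtain rfl : t = x := by simpa using hx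
  exact ha t (by simp)

theorem isLRMax_ins (H : IsShortUIO A r) {w : List ℕ} {y z : ℕ} (hyz : r y z) :
    IsLRMax r (ins r z w) y ↔ IsLRMax r w y := by
  have hne : y ≠ z := (H.lt hyz).ne
  obtain ⟨a, b, rfl, ha, hb⟩ := exists_prefix r z w
  rw [ins_append ha hb]
  constructor
  · rintro ⟨a', b', he, h0, ha'⟩
    rcases List.append_eq_append_iff.1 he with ⟨c, rfl, hc⟩ | ⟨c, rfl, hc⟩
    · rcases c with _ | ⟨t, c⟩
      · simp_all
      · obtain ⟨rfl, rfl⟩ : z = t ∧ b = c ++ y :: b' := by simpa using hc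
        exact ((H.lt hyz).not_gt (H.lt (ha' z (by simp)))).elim
    · rcases c with _ | ⟨t, c⟩
      · simp_all
      · obtain ⟨rfl, rfl⟩ : y = t ∧ b' = c ++ z :: b := by simpa using hc
        exact ⟨a', c ++ b, by simp, h0, ha'⟩
  · rintro ⟨a', b', he, h0, ha'⟩
    rcases List.append_eq_append_iff.1 he with ⟨c, rfl, rfl⟩ | ⟨c, rfl, hc⟩
    · rcases c with _ | ⟨t, c⟩
      · exact (hb y (by simp) hyz).elim
      · exact (hb t (by simp) (H.trans (ha' t (by simp)) hyz)).elim
    · rcases c with _ | ⟨t, c⟩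
      · obtain rfl : y :: b' = b := by simpa using hc
        exact (hb y (by simp) hyz).elim
      · obtain ⟨rfl, rfl⟩ : y = t ∧ b' = c ++ b := by simpa using hc
        exact ⟨a', c ++ z :: b, by simp, h0, ha'⟩

theorem IsLRMax.comparable {w : List ℕ} {y z : ℕ} (hy : IsLRMax r w y) (hz : IsLRMax r w z) :
    y = z ∨ r y z ∨ r z y := by
  obtain ⟨a, b, rfl, -, ha⟩ := hy
  obtain ⟨a', b', he, -, ha'⟩ := hz
  rcases List.append_eq_append_iff.1 he with ⟨c, rfl, hc⟩ | ⟨c, rfl, hc⟩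
  all_goals
    rcases c with _ | ⟨t, c⟩
    · simp_all
    · simp_all

/-- The set of nontrivial left-to-right maxima of `w`. -/
noncomputable def lrSet (A : Finset ℕ) (r : ℕ → ℕ → Prop) (w : List ℕ) : Finset ℕ :=
  A.filter (IsLRMax r w)

theorem sum_markedWords {M : Type*} [AddCommMonoid M] (m : ℕ) (f : ℕ → List ℕ → M) :
    ∑ t ∈ markedWords A r m, f t.1 t.2 = ∑ w ∈ ndWords A r m, ∑ y ∈ lrSet A r w, f y w := by
  simp only [markedWords, lrSet, Finset.sum_filter]
  rw [Finset.sum_product_right]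

theorem lrSet_count (H : IsShortUIO A r) (w : List ℕ) :
    (if lrSet A r w = ∅ then 1 else 0 : ℤ) = 1 - ((lrSet A r w).card : ℤ) +
      ∑ z ∈ lrSet A r w, (((lrSet A r w).filter fun y => r y z).card : ℤ) := by
  have irr : ∀ x, ¬ r x x := fun x h => (H.lt h).false
  have hlt : ∀ {x y}, r x y → x < y := H.lt
  rcases Finset.eq_empty_or_nonempty (lrSet A r w) with h0 | ⟨y, hy⟩
  · simp [h0]
  rw [if_neg (Finset.ne_empty_of_mem hy)]
  by_cases h1 : ∃ z ∈ lrSet A r w, z ≠ y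
  · have key : ∀ y z, IsLRMax r w y → IsLRMax r w z → r y z → lrSet A r w ⊆ {y, z} := by
      intro y z hy hz hyz t ht
      have ht := (Finset.mem_filter.1 ht).2
      obtain ⟨x, hx⟩ : ∃ x, x ∈ w.head? := by
        obtain ⟨a, b, rfl, h0, ha⟩ := hy
        obtain ⟨x, a, rfl⟩ := List.exists_cons_of_ne_nil h0
        exact ⟨x, by simp⟩
      simp only [Finset.mem_insert, Finset.mem_singleton]
      rcases hy.comparable ht with rfl | h | h
      · simp
      · rcases hz.comparable ht with rfl | h' | h'
        · simp
        · exact (H.no_four (hy.head hx) hyz h').elim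
        · exact (H.no_four (hy.head hx) h h').elim
      · exact (H.no_four (ht.head hx) h hyz).elim
    have fin : ∀ y z, y ∈ lrSet A r w → z ∈ lrSet A r w → r y z → (0 : ℤ) =
        1 - ((lrSet A r w).card : ℤ) +
          ∑ z ∈ lrSet A r w, (((lrSet A r w).filter fun y => r y z).card : ℤ) := by
      intro y z hy hz hyz
      have e : lrSet A r w = {y, z} := by
        refine (key y z (Finset.mem_filter.1 hy).2 (Finset.mem_filter.1 hz).2 hyz).antisymm ?_
        simp [Finset.insert_subset_iff, hy, hz]
      have hzy : ¬ r z y := fun h => (hlt h).not_gt (hlt hyz)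
      rw [e, Finset.sum_pair (hlt hyz).ne, Finset.card_pair (hlt hyz).ne]
      simp [Finset.filter_insert, Finset.filter_singleton, irr, hzy, hyz]
    obtain ⟨z, hz, hne⟩ := h1
    rcases (Finset.mem_filter.1 hy).2.comparable (Finset.mem_filter.1 hz).2 with rfl | h | h
    · exact absurd rfl hne
    · exact fin y z hy hz h
    · exact fin z y hz hy h
  · have e : lrSet A r w = {y} := by
      ext t
      push Not at h1
      simp only [Finset.mem_singleton]
      exact ⟨h1 t, by rintro rfl; exact hy⟩
    simp [e, Finset.filter_singleton, irr]

/-- Descent-free words without nontrivial left-to-right maxima. -/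
noncomputable def goodWords (A : Finset ℕ) (r : ℕ → ℕ → Prop) (m : ℕ) : Finset (List ℕ) :=
  (ndWords A r m).filter fun w => lrSet A r w = ∅

/-- A noncommutative power sum. -/
noncomputable def p (A : Finset ℕ) (r : ℕ → ℕ → Prop) (m : ℕ) :
    Module.End ℤ[X] (Finset ℕ → ℤ[X]) :=
  ∑ w ∈ goodWords A r m, U r w

theorem sum_lrSet_pairs (H : IsShortUIO A r) (m : ℕ) :
    ∑ w ∈ ndWords A r (m + 2), (∑ z ∈ lrSet A r w,
        (((lrSet A r w).filter fun y => r y z).card : ℤ)) • U r w =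
      ∑ t ∈ descPairs A r m, ∑ z ∈ A, if r t.1 z then u r z * (u r t.1 * U r t.2) else 0 := by
  have e1 : ∑ w ∈ ndWords A r (m + 2), (∑ z ∈ lrSet A r w,
        (((lrSet A r w).filter fun y => r y z).card : ℤ)) • U r w =
      ∑ t ∈ descPairs A r (m + 1),
        (((lrSet A r t.2).filter fun y => r y t.1).card : ℤ) • (u r t.1 * U r t.2) := by
    simp only [Finset.sum_smul]
    rw [← sum_markedWords (m + 2)
      (fun z w => (((lrSet A r w).filter fun y => r y z).card : ℤ) • U r w), ← H.sum_ins (m + 1)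
      (fun z w => (((lrSet A r w).filter fun y => r y z).card : ℤ) • U r w)]
    refine Finset.sum_congr rfl fun t _ => ?_
    rw [H.U_ins]
    congr 3
    ext y
    simp only [lrSet, Finset.mem_filter]
    constructor
    · rintro ⟨⟨h1, h2⟩, h3⟩
      exact ⟨⟨h1, (H.isLRMax_ins h3).1 h2⟩, h3⟩
    · rintro ⟨⟨h1, h2⟩, h3⟩
      exact ⟨⟨h1, (H.isLRMax_ins h3).2 h2⟩, h3⟩
  have e2 : ∑ t ∈ descPairs A r m, ∑ z ∈ A,
        (if r t.1 z then u r z * (u r t.1 * U r t.2) else 0) =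
      ∑ w ∈ ndWords A r (m + 1), ∑ y ∈ lrSet A r w, ∑ z ∈ A,
        if r y z then u r z * U r w else 0 := by
    have key := H.sum_ins m (fun y w => ∑ z ∈ A, if r y z then u r z * U r w else 0)
    simp only [H.U_ins] at key
    rw [key, sum_markedWords (m + 1) (fun y w => ∑ z ∈ A, if r y z then u r z * U r w else 0)]
  rw [e1, e2, descPairs, Finset.sum_filter, Finset.sum_product_right]
  refine Finset.sum_congr rfl fun w _ => ?_
  rw [Finset.sum_comm]
  refine Finset.sum_congr rfl fun z _ => ?_
  rw [← Finset.sum_filter, Finset.sum_const, natCast_zsmul]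
  split_ifs with hh
  · rfl
  · rw [Finset.filter_eq_empty_iff.2, Finset.card_empty, zero_smul]
    intro y hy hyz
    have hy := (Finset.mem_filter.1 hy).2
    obtain ⟨a, b, rfl, h0, ha⟩ := hy
    obtain ⟨x, a, rfl⟩ := List.exists_cons_of_ne_nil h0
    exact hh ⟨x, by simp, H.trans (ha x (by simp)) hyz⟩

theorem sum_descPairs_extend (H : IsShortUIO A r) (m : ℕ) :
    (∑ t ∈ descPairs A r (m + 1), ∑ z ∈ A,
      if r t.1 z then u r z * (u r t.1 * U r t.2) else 0) = e3 A r * h A r m := by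
  rw [e3, h, Finset.sum_mul_sum, ← Finset.sum_product', ← Finset.sum_product', ← Finset.sum_filter]
  refine Finset.sum_nbij' (fun t => ((t.1.2.headD 0, t.1.1, t.2), t.1.2.tail))
    (fun t => ((t.1.2.1, t.1.1 :: t.2), t.1.2.2)) ?_ ?_ ?_ ?_ ?_
  · rintro ⟨⟨y, _ | ⟨x, v⟩⟩, z⟩ hm
    · simp [mem_descPairs] at hm
    · simp only [Finset.mem_filter, Finset.mem_product, mem_descPairs, mem_ndWords, H.mem_chain3,
        noDesc_cons] at hm ⊢
      simp_all
  · rintro ⟨⟨x, y, z⟩, v⟩ hm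
    simp only [Finset.mem_filter, Finset.mem_product, mem_descPairs, mem_ndWords, H.mem_chain3,
      noDesc_cons] at hm ⊢
    obtain ⟨⟨h1, h2⟩, h3, h4, h5⟩ := hm
    have := H.mem_left h1
    have := H.mem_left h2
    have := H.mem_right h2
    have : ∀ t ∈ v.head?, ¬ r t x := fun t _ ht => H.no_four ht h1 h2
    simp_all
  · rintro ⟨⟨y, _ | ⟨x, v⟩⟩, z⟩ hm
    · simp [mem_descPairs] at hm
    · rfl
  · rintro ⟨⟨x, y, z⟩, v⟩ hm
    rfl
  · rintro ⟨⟨y, _ | ⟨x, v⟩⟩, z⟩ hm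
    · simp [mem_descPairs] at hm
    · simp only [Finset.mem_filter, Finset.mem_product, mem_descPairs] at hm
      have hxy : r x y := by simpa using hm.1.1.2.2
      have hyz : r y z := hm.2
      simp only [U_cons, List.headD_cons, List.tail_cons]
      rw [← mul_assoc (u r y), ← (H.u_comm hxy).eq, mul_assoc, ← mul_assoc,
        ← (H.u_comm (H.trans hxy hyz)).eq, mul_assoc, ← mul_assoc (u r z), ← (H.u_comm hyz).eq]
      simp only [mul_assoc]

theorem p_eq (H : IsShortUIO A r) (m : ℕ) :
    p A r (m + 2) = h A r (m + 2) - hook A r m + ∑ t ∈ descPairs A r m, ∑ z ∈ A,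
      if r t.1 z then u r z * (u r t.1 * U r t.2) else 0 := by
  have e : ∑ w ∈ ndWords A r (m + 2), ((lrSet A r w).card : ℤ) • U r w = hook A r m := by
    rw [← H.sum_descPairs_succ]
    simp only [← H.U_ins]
    rw [H.sum_ins (m + 1) (fun _ w => U r w), sum_markedWords (m + 2) (fun _ w => U r w)]
    simp
  rw [← H.sum_lrSet_pairs, ← e, h, ← Finset.sum_sub_distrib, ← Finset.sum_add_distrib, p,
    goodWords, Finset.sum_filter]
  refine Finset.sum_congr rfl fun w _ => ?_
  have := congrArg (fun c : ℤ => c • U r w) (H.lrSet_count w)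
  simp only [add_smul, sub_smul, one_smul, ite_smul, zero_smul] at this
  exact this

theorem p_two (H : IsShortUIO A r) : p A r 2 = h A r 2 - hook A r 0 := by
  rw [H.p_eq 0, descPairs_zero]
  simp

theorem p_add_three (H : IsShortUIO A r) (m : ℕ) :
    p A r (m + 3) = h A r (m + 3) - hook A r (m + 1) + e3 A r * h A r m := by
  rw [H.p_eq (m + 1), H.sum_descPairs_extend]

/-- Operators preserving functions whose values have nonnegative coefficients. -/
def IsPos (F : Module.End ℤ[X] (Finset ℕ → ℤ[X])) : Prop :=
  ∀ f : Finset ℕ → ℤ[X], (∀ S k, 0 ≤ (f S).coeff k) → ∀ S k, 0 ≤ (F f S).coeff k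

theorem IsPos.mul {F G : Module.End ℤ[X] (Finset ℕ → ℤ[X])} (hF : IsPos F) (hG : IsPos G) :
    IsPos (F * G) := fun f hf => hF _ (hG f hf)

theorem IsPos.one : IsPos 1 := fun _ hf => hf

theorem IsPos.add {F G : Module.End ℤ[X] (Finset ℕ → ℤ[X])} (hF : IsPos F) (hG : IsPos G) :
    IsPos (F + G) := fun f hf S k => by
  simpa using add_nonneg (hF f hf S k) (hG f hf S k)

theorem IsPos.zero : IsPos 0 := fun f hf S k => by simp

theorem IsPos.sum {ι : Type*} {s : Finset ι} {F : ι → Module.End ℤ[X] (Finset ℕ → ℤ[X])}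
    (hF : ∀ i ∈ s, IsPos (F i)) : IsPos (∑ i ∈ s, F i) := by
  induction s using Finset.induction_on with
  | empty => simpa using IsPos.zero
  | insert a s ha ih =>
    rw [Finset.sum_insert ha]
    exact (hF a (by simp)).add (ih fun i hi => hF i (by simp [hi]))

theorem isPos_u (a : ℕ) : IsPos (u r a) := fun f hf S k => by
  rw [u_apply]
  split_ifs
  · rw [coeff_X_pow_mul']
    split_ifs
    · exact hf _ _
    · exact le_rfl
  · simp

theorem isPos_U (w : List ℕ) : IsPos (U r w) := by
  induction w with
  | nil => exact IsPos.one
  | cons a w ih => exact U_cons (r := r) a w ▸ (isPos_u a).mul ih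

theorem isPos_e2 : IsPos (e2 A r) := IsPos.sum fun _ _ => (isPos_u _).mul (isPos_u _)

theorem isPos_e3 : IsPos (e3 A r) :=
  IsPos.sum fun _ _ => (isPos_u _).mul ((isPos_u _).mul (isPos_u _))

theorem isPos_p_mul_sub (m : ℕ) : IsPos (p A r m * e1 A r - p A r (m + 1)) := by
  have hinj : Set.InjOn (fun t : List ℕ × ℕ => t.1 ++ [t.2]) (goodWords A r m ×ˢ A : Finset _) := by
    rintro ⟨v, c⟩ _ ⟨v', c'⟩ _ heq
    simpa using heq
  have e : p A r m * e1 A r =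
      ∑ w ∈ (goodWords A r m ×ˢ A).image (fun t => t.1 ++ [t.2]), U r w := by
    rw [Finset.sum_image hinj, p, e1, Finset.sum_mul_sum, ← Finset.sum_product']
    simp
  have hsub : goodWords A r (m + 1) ⊆ (goodWords A r m ×ˢ A).image (fun t => t.1 ++ [t.2]) := by
    intro w hw
    simp only [goodWords, Finset.mem_filter, mem_ndWords, lrSet, Finset.filter_eq_empty_iff] at hw
    obtain ⟨⟨h1, h2, h3⟩, h4⟩ := hw
    obtain ⟨v, c, rfl⟩ : ∃ v c, w = v ++ [c] := by
      rcases List.eq_nil_or_concat w with rfl | ⟨v, c, rfl⟩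
      · simp at h1
      · exact ⟨v, c, by simp⟩
    refine Finset.mem_image.2 ⟨(v, c), ?_, rfl⟩
    simp only [goodWords, Finset.mem_filter, mem_ndWords, lrSet, Finset.filter_eq_empty_iff,
      Finset.mem_product]
    refine ⟨⟨⟨by simpa using h1, fun x hx => h2 x (by simp [hx]),
      (List.isChain_append.1 h3).1⟩, fun y hy hv => h4 hy ?_⟩, h2 c (by simp)⟩
    obtain ⟨a, b, rfl, h0, ha⟩ := hv
    exact ⟨a, b ++ [c], by simp, h0, ha⟩
  rw [e, p, ← Finset.sum_sdiff hsub, add_sub_cancel_right]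
  exact IsPos.sum fun w _ => isPos_U w

theorem isPos_three (H : IsShortUIO A r) : IsPos (hook A r 1 - e3 A r) := by
  have e : hook A r 1 - e3 A r = (p A r 2 * e1 A r - p A r 3) + e3 A r := by
    rw [H.p_two, H.p_add_three 0, H.h_succ_succ 1, H.h_succ_succ 0, H.hook_succ 0, hook_zero,
      h_one, h_zero, sub_mul, sub_mul]
    simp only [mul_sub, mul_one, mul_assoc, H.e1_comm_e2.eq]
    abel
  rw [e]
  exact (isPos_p_mul_sub 2).add isPos_e3

theorem isPos_four (H : IsShortUIO A r) :
    IsPos (hook A r 2 - hook22 A r 0 - e3 A r * h A r 1) := by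
  have e : hook A r 2 - hook22 A r 0 - e3 A r * h A r 1 = p A r 3 * e1 A r - p A r 4 := by
    rw [H.p_add_three 0, H.p_add_three 1, H.h_succ_succ 2, H.hook22_eq, sub_eq_sub_iff_add_eq_add,
      add_mul, sub_mul, ← (H.e1_comm_h 3).eq, H.hook_succ 0, H.hook_succ 1, H.h_succ_succ 0,
      hook_zero, h_one, h_zero]
    simp only [mul_sub, sub_mul, mul_one, mul_assoc]
    abel
  rw [e]
  exact isPos_p_mul_sub 3

theorem isPos_add_five (H : IsShortUIO A r) (m : ℕ) :
    IsPos (hook A r (m + 3) - hook22 A r (m + 1) + e3 A r * hook A r m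
      - e3 A r * h A r (m + 2)) := by
  have e : hook A r (m + 3) - hook22 A r (m + 1) + e3 A r * hook A r m
      - e3 A r * h A r (m + 2) = p A r (m + 4) * e1 A r - p A r (m + 5) := by
    rw [H.p_add_three (m + 1), H.p_add_three (m + 2), H.h_succ_succ (m + 3), H.hook22_eq,
      add_mul, sub_mul, ← (H.e1_comm_h (m + 4)).eq]
    simp only [H.hook_succ]
    simp only [mul_sub, sub_mul, mul_assoc, ← (H.e1_comm_h _).eq]
    have h1 : e1 A r * h A r (m + 2) = h A r (m + 3) + hook A r (m + 1) := by
      rw [H.h_succ_succ (m + 1)]; abel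
    have h2 : e1 A r * h A r (m + 1) = h A r (m + 2) + hook A r m := by
      rw [H.h_succ_succ m]; abel
    rw [h1, h2, H.hook_succ]
    simp only [mul_sub, mul_add]
    abel
  rw [e]
  exact isPos_p_mul_sub _

/-- The row and column conditions on the reading word `L` of a tableau of shape `μ`. -/
def IsTab (r : ℕ → ℕ → Prop) (μ L : List ℕ) : Prop :=
  (∀ i j : ℕ, i < μ.length → j + 1 < μ.getD i 0 → r (entry μ L i j) (entry μ L i (j + 1))) ∧
  (∀ i j : ℕ, i + 1 < μ.length → j < μ.getD (i + 1) 0 →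
    ¬ r (entry μ L (i + 1) j) (entry μ L i j))

theorem entry_cons_zero (k : ℕ) (μ L : List ℕ) (j : ℕ) : entry (k :: μ) L 0 j = L.getD j 0 := by
  simp [entry, rowStart]

theorem entry_zero (μ L : List ℕ) (j : ℕ) : entry μ L 0 j = L.getD j 0 := by
  simp [entry, rowStart]

theorem entry_cons_succ (k : ℕ) (μ L : List ℕ) (i j : ℕ) :
    entry (k :: μ) L (i + 1) j = entry μ (L.drop k) i j := by
  simp [entry, rowStart, add_assoc]

theorem isTab_nil (L : List ℕ) : IsTab r [] L := by simp [IsTab]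

theorem isTab_cons (k : ℕ) (μ L : List ℕ) :
    IsTab r (k :: μ) L ↔ (∀ j, j + 1 < k → r (L.getD j 0) (L.getD (j + 1) 0)) ∧
      (∀ j < μ.getD 0 0, ¬ r ((L.drop k).getD j 0) (L.getD j 0)) ∧ IsTab r μ (L.drop k) := by
  constructor
  · intro h
    refine ⟨fun j hj => ?_, fun j hj => ?_, fun i j hi hj => ?_, fun i j hi hj => ?_⟩
    · simpa only [entry_cons_zero] using h.1 0 j (by simp) (by simpa using hj)
    · have hμ : 0 < μ.length := by
        rcases μ with _ | _
        · simp at hj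
        · simp
      simpa only [entry_cons_succ, entry_zero] using h.2 0 j (by simpa using hμ) (by simpa using hj)
    · simpa only [entry_cons_succ] using h.1 (i + 1) j (by simpa using hi) (by simpa using hj)
    · simpa only [entry_cons_succ] using h.2 (i + 1) j (by simpa using hi) (by simpa using hj)
  · rintro ⟨h1, h2, h3⟩
    constructor
    · rintro (_ | i) j hi hj
      · simpa only [entry_cons_zero] using h1 j (by simpa using hj)
      · simpa only [entry_cons_succ] using h3.1 i j (by simpa using hi) (by simpa using hj)
    · rintro (_ | i) j hi hj
      · simpa only [entry_cons_succ, entry_zero] using h2 j (by simpa using hj)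
      · simpa only [entry_cons_succ] using h3.2 i j (by simpa using hi) (by simpa using hj)

theorem isTab_ones {L : List ℕ} : IsTab r (List.replicate L.length 1) L ↔ NoDesc r L := by
  induction L with
  | nil => simp [isTab_nil, NoDesc]
  | cons x L ih =>
    rw [List.length_cons, List.replicate_succ, isTab_cons, noDesc_cons]
    rcases L with _ | ⟨y, L⟩
    · simp [isTab_nil, NoDesc]
    · simp only [List.length_cons, List.replicate_succ, List.drop_succ_cons, List.drop_zero,
        List.getD_cons_zero, Nat.lt_one_iff] at ih ⊢
      rw [ih]
      simp

theorem isTab_two {x y : ℕ} {v : List ℕ} :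
    IsTab r (2 :: List.replicate v.length 1) (x :: y :: v) ↔ r x y ∧ NoDesc r (x :: v) := by
  rw [isTab_cons, noDesc_cons]
  simp only [List.drop_succ_cons, List.drop_zero, isTab_ones]
  refine and_congr ?_ (and_congr ?_ Iff.rfl)
  · exact ⟨fun h => by simpa using h 0, fun h j hj => by
      obtain rfl : j = 0 := by omega
      simpa using h⟩
  · rcases v with _ | ⟨z, v⟩ <;> simp [List.replicate_succ]

theorem isTab_two_two {x y x' y' : ℕ} {v : List ℕ} :
    IsTab r (2 :: 2 :: List.replicate v.length 1) (x :: y :: x' :: y' :: v) ↔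
      r x y ∧ ¬ (r x' x ∨ r y' y) ∧ r x' y' ∧ NoDesc r (x' :: v) := by
  rw [isTab_cons]
  simp only [List.drop_succ_cons, List.drop_zero, isTab_two]
  refine and_congr ?_ (and_congr ?_ Iff.rfl)
  · exact ⟨fun h => by simpa using h 0, fun h j hj => by
      obtain rfl : j = 0 := by omega
      simpa using h⟩
  · rw [not_or]
    refine ⟨fun h => ⟨by simpa using h 0, by simpa using h 1⟩, fun h j hj => ?_⟩
    have : j < 2 := by simpa using hj
    interval_cases j <;> simp [h]

theorem isTab_three (H : IsShortUIO A r) {x y z : ℕ} {v μ : List ℕ} (hμ : μ.getD 0 0 ≤ 3) :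
    IsTab r (3 :: μ) (x :: y :: z :: v) ↔ (r x y ∧ r y z) ∧ IsTab r μ v := by
  rw [isTab_cons]
  simp only [List.drop_succ_cons, List.drop_zero]
  constructor
  · rintro ⟨h1, -, h3⟩
    exact ⟨⟨by simpa using h1 0, by simpa using h1 1⟩, h3⟩
  · rintro ⟨⟨hxy, hyz⟩, h3⟩
    refine ⟨fun j hj => ?_, fun j hj hr => ?_, h3⟩
    · have : j < 2 := by omega
      interval_cases j <;> simpa
    · have hrow : ∀ i, i + 1 < μ.getD 0 0 → r (v.getD i 0) (v.getD (i + 1) 0) := fun i hi => by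
        rcases μ with _ | ⟨k, μ⟩
        · simp at hi
        · simpa only [entry_zero] using h3.1 0 i (by simp) hi
      have : j < 3 := by omega
      interval_cases j
      · exact H.no_four (by simpa using hr) hxy hyz
      · exact H.no_four (hrow 0 hj) (by simpa using hr) hyz
      · exact H.no_four (hrow 0 (by omega)) (hrow 1 hj) (by simpa using hr)

/-- Sum of the tableaux of shape `μ`. -/
noncomputable def tabSum (A : Finset ℕ) (r : ℕ → ℕ → Prop) (μ : List ℕ) :
    Module.End ℤ[X] (Finset ℕ → ℤ[X]) :=
  ∑ L ∈ (words A μ.sum).filter (IsTab r μ), U r L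

theorem tabSum_ones (m : ℕ) : tabSum A r (List.replicate m 1) = h A r m := by
  rw [tabSum, h, ndWords]
  refine Finset.sum_congr ?_ fun _ _ => rfl
  ext L
  simp only [Finset.mem_filter, mem_words, List.sum_replicate, smul_eq_mul, mul_one]
  refine and_congr_right fun hL => ?_
  rw [← hL.1, isTab_ones]

theorem tabSum_two (H : IsShortUIO A r) (m : ℕ) :
    tabSum A r (2 :: List.replicate m 1) = hook A r m := by
  rw [tabSum, hook]
  symm
  refine Finset.sum_nbij (fun t => t.1.1 :: t.1.2 :: t.2) ?_ ?_ ?_ ?_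
  · rintro ⟨⟨x, y⟩, v⟩ ht
    obtain ⟨hxy, hv, hvA, hnd⟩ := H.mem_hookWords.1 ht
    subst hv
    rw [Finset.mem_filter, mem_words]
    rw [isTab_two]
    refine ⟨⟨by simp; omega, ?_⟩, hxy, hnd⟩
    simpa [H.mem_left hxy, H.mem_right hxy] using hvA
  · rintro ⟨⟨x, y⟩, v⟩ - ⟨⟨x', y'⟩, v'⟩ - h
    simp_all
  · rintro L hL
    rw [Finset.mem_coe, Finset.mem_filter, mem_words] at hL
    rcases L with _ | ⟨x, _ | ⟨y, v⟩⟩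
    · simp at hL; omega
    · simp at hL; omega
    · obtain ⟨⟨hl, hA⟩, hT⟩ := hL
      obtain rfl : v.length = m := by simp at hl; omega
      rw [isTab_two] at hT
      exact ⟨((x, y), v),
        H.mem_hookWords.2 ⟨hT.1, rfl, fun t ht => hA t (by simp [ht]), hT.2⟩, rfl⟩
  · rintro ⟨⟨x, y⟩, v⟩ -
    simp [mul_assoc]

theorem tabSum_two_two (H : IsShortUIO A r) (m : ℕ) :
    tabSum A r (2 :: 2 :: List.replicate m 1) = hook22 A r m := by
  rw [tabSum, hook22]
  symm
  refine Finset.sum_nbij (fun t => t.1.1 :: t.1.2 :: t.2.1.1 :: t.2.1.2 :: t.2.2) ?_ ?_ ?_ ?_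
  · rintro ⟨⟨x, y⟩, ⟨x', y'⟩, v⟩ ht
    rw [Finset.mem_filter, Finset.mem_product, H.mem_chain2] at ht
    obtain ⟨⟨hxy, hv⟩, hcol⟩ := ht
    obtain ⟨hxy', hv, hvA, hnd⟩ := H.mem_hookWords.1 hv
    subst hv
    rw [Finset.mem_filter, mem_words, isTab_two_two]
    refine ⟨⟨by simp; omega, ?_⟩, hxy, hcol, hxy', hnd⟩
    simpa [H.mem_left hxy, H.mem_right hxy, H.mem_left hxy', H.mem_right hxy'] using hvA
  · rintro ⟨⟨x, y⟩, ⟨x', y'⟩, v⟩ - ⟨⟨_, _⟩, ⟨_, _⟩, _⟩ - h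
    simp_all
  · rintro L hL
    rw [Finset.mem_coe, Finset.mem_filter, mem_words] at hL
    rcases L with _ | ⟨x, _ | ⟨y, _ | ⟨x', _ | ⟨y', v⟩⟩⟩⟩
    · simp at hL; omega
    · simp at hL; omega
    · simp at hL
    · simp at hL; omega
    · obtain ⟨⟨hl, hA⟩, hT⟩ := hL
      obtain rfl : v.length = m := by simp at hl; omega
      rw [isTab_two_two] at hT
      refine ⟨((x, y), (x', y'), v), ?_, rfl⟩
      rw [Finset.mem_coe, Finset.mem_filter, Finset.mem_product, H.mem_chain2]
      exact ⟨⟨hT.1, H.mem_hookWords.2 ⟨hT.2.2.1, rfl, fun t ht => hA t (by simp [ht]),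
        hT.2.2.2⟩⟩, hT.2.1⟩
  · rintro ⟨⟨x, y⟩, ⟨x', y'⟩, v⟩ -
    simp [mul_assoc]

theorem tabSum_three (H : IsShortUIO A r) {μ : List ℕ} (hμ : μ.getD 0 0 ≤ 3) :
    tabSum A r (3 :: μ) = e3 A r * tabSum A r μ := by
  rw [tabSum, tabSum, e3, Finset.sum_mul_sum, ← Finset.sum_product']
  symm
  refine Finset.sum_nbij (fun t => t.1.1 :: t.1.2.1 :: t.1.2.2 :: t.2) ?_ ?_ ?_ ?_
  · rintro ⟨⟨x, y, z⟩, v⟩ ht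
    rw [Finset.mem_product, H.mem_chain3, Finset.mem_filter, mem_words] at ht
    obtain ⟨hxyz, ⟨hv, hvA⟩, hT⟩ := ht
    rw [Finset.mem_filter, mem_words, H.isTab_three hμ]
    refine ⟨⟨by simp at hv ⊢; omega, ?_⟩, hxyz, hT⟩
    simpa [H.mem_left hxyz.1, H.mem_left hxyz.2, H.mem_right hxyz.2] using hvA
  · rintro ⟨⟨x, y, z⟩, v⟩ - ⟨⟨_, _, _⟩, _⟩ - h
    simp_all
  · rintro L hL
    rw [Finset.mem_coe, Finset.mem_filter, mem_words] at hL
    rcases L with _ | ⟨x, _ | ⟨y, _ | ⟨z, v⟩⟩⟩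
    · simp at hL; omega
    · simp at hL; omega
    · simp at hL; omega
    · obtain ⟨⟨hl, hA⟩, hT⟩ := hL
      rw [H.isTab_three hμ] at hT
      refine ⟨((x, y, z), v), ?_, rfl⟩
      rw [Finset.mem_coe, Finset.mem_product, H.mem_chain3, Finset.mem_filter, mem_words]
      exact ⟨hT.1, ⟨by simp at hl ⊢; omega, fun t ht => hA t (by simp [ht])⟩, hT.2⟩
  · rintro ⟨⟨x, y, z⟩, v⟩ -
    simp [mul_assoc]

theorem IsPos.pow {F : Module.End ℤ[X] (Finset ℕ → ℤ[X])} (hF : IsPos F) (l : ℕ) :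
    IsPos (F ^ l) := by
  induction l with
  | zero => simpa using IsPos.one
  | succ l ih => rw [pow_succ]; exact ih.mul hF

theorem tabSum_threes (H : IsShortUIO A r) {μ : List ℕ} (hμ : μ.getD 0 0 ≤ 3) (l : ℕ) :
    tabSum A r (List.replicate l 3 ++ μ) = e3 A r ^ l * tabSum A r μ := by
  induction l with
  | zero => simp
  | succ l ih =>
    rw [List.replicate_succ, List.cons_append, H.tabSum_three, ih, pow_succ', mul_assoc]
    rcases l with _ | l
    · simpa using hμ
    · simp [List.replicate_succ]

/-- The number of pairs of positions of a word whose letters are related by `q`. -/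
noncomputable def pairCount (q : ℕ → ℕ → Prop) : List ℕ → ℕ
  | [] => 0
  | x :: L => L.countP (q x) + pairCount q L

/-- `x` is larger than `y` and incomparable to it. -/
def Inverts (r : ℕ → ℕ → Prop) (x y : ℕ) : Prop := y < x ∧ ¬ r x y ∧ ¬ r y x

/-- The indicator of the empty set. -/
noncomputable def delta (S : Finset ℕ) : ℤ[X] := if S = ∅ then 1 else 0

theorem U_delta (L : List ℕ) (S : Finset ℕ) :
    U r L delta S = if L.Nodup ∧ L.toFinset = S then X ^ pairCount (Inverts r) L else 0 := by
  induction L generalizing S with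
  | nil => simp [delta, pairCount, eq_comm]
  | cons x L ih =>
    rw [U_cons, Module.End.mul_apply, u_apply, ih]
    by_cases hx : x ∈ S
    · rw [if_pos hx]
      by_cases hL : L.Nodup ∧ L.toFinset = S.erase x
      · have hxL : x ∉ L := by
          rw [← List.mem_toFinset, hL.2]
          simp
        rw [if_pos hL, if_pos (by simp [hxL, hL, hx]), pairCount, pow_add, ← hL.2, invCount,
          List.countP_eq_length_filter, ← List.toFinset_card_of_nodup (hL.1.filter _),
          List.toFinset_filter]
        congr 3
        ext
        rw [Finset.mem_filter, Finset.mem_filter, decide_eq_true_eq, Inverts]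
      · rw [if_neg hL, if_neg, mul_zero]
        rintro ⟨h1, rfl⟩
        rw [List.nodup_cons] at h1
        exact hL ⟨h1.2, by simp [h1.1]⟩
    · rw [if_neg hx, if_neg]
      rintro ⟨-, rfl⟩
      simp at hx

theorem tabSum_delta {μ : List ℕ} (S : Finset ℕ) :
    tabSum A r μ delta S =
      ∑ L ∈ (words A μ.sum).filter (fun L => IsTab r μ L ∧ L.Nodup ∧ L.toFinset = S),
        X ^ pairCount (Inverts r) L := by
  rw [tabSum, LinearMap.sum_apply, Finset.sum_apply, ← Finset.filter_filter]
  simp only [U_delta]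
  exact (Finset.sum_filter _ _).symm

theorem mem_cellsOf {μ : List ℕ} {c : ℕ × ℕ} : c ∈ cellsOf μ ↔ c.2 < μ.getD c.1 0 := by
  rw [cellsOf, Finset.mem_filter, Finset.mem_product, Finset.mem_range, Finset.mem_range,
    and_iff_right_iff_imp]
  intro h
  have hc : c.1 < μ.length := by
    by_contra hc
    rw [List.getD_eq_default _ _ (not_lt.1 hc)] at h
    omega
  refine ⟨hc, h.trans_le ?_⟩
  rw [List.getD_eq_getElem _ _ hc]
  clear h
  generalize c.1 = i at hc
  induction μ generalizing i with
  | nil => simp at hc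
  | cons k μ ih => rcases i with _ | i <;> simp_all

theorem sum_cellsOf_cons {M : Type*} [AddCommMonoid M] (k : ℕ) (μ : List ℕ) (f : ℕ × ℕ → M) :
    ∑ c ∈ cellsOf (k :: μ), f c =
      ∑ j ∈ Finset.range k, f (0, j) + ∑ c ∈ cellsOf μ, f (c.1 + 1, c.2) := by
  have hcells : cellsOf (k :: μ) = (Finset.range k).image (fun j => (0, j)) ∪
      (cellsOf μ).image (fun c => (c.1 + 1, c.2)) := by
    ext ⟨i, j⟩
    rcases i with _ | i <;> simp [mem_cellsOf]
  rw [hcells, Finset.sum_union, Finset.sum_image (by simp), Finset.sum_image]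
  · rintro ⟨a, b⟩ - ⟨c, d⟩ -
    simp
  · rw [Finset.disjoint_left]
    simp

theorem sum_range_getD {M : Type*} [AddCommMonoid M] (f : ℕ → M) (a b : List ℕ) :
    ∑ j ∈ Finset.range a.length, f ((a ++ b).getD j 0) = (a.map f).sum := by
  induction a with
  | nil => simp
  | cons x a ih => simp [Finset.sum_range_succ', ← ih, add_comm]

theorem exists_append_of_length {L : List ℕ} {k m : ℕ} (h : L.length = k + m) :
    ∃ a b, L = a ++ b ∧ a.length = k ∧ b.length = m :=
  ⟨L.take k, L.drop k, (List.take_append_drop k L).symm, by simp [h], by simp [h]⟩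

theorem sum_cellsOf_entry {M : Type*} [AddCommMonoid M] (f : ℕ → M) {μ L : List ℕ}
    (hL : L.length = μ.sum) : ∑ c ∈ cellsOf μ, f (entry μ L c.1 c.2) = (L.map f).sum := by
  induction μ generalizing L with
  | nil =>
    obtain rfl : L = [] := by simpa using hL
    simp [cellsOf]
  | cons k μ ih =>
    obtain ⟨a, b, rfl, rfl, hb⟩ := exists_append_of_length (hL.trans List.sum_cons)
    simp only [sum_cellsOf_cons, entry_cons_zero, entry_cons_succ, List.drop_left]
    rw [sum_range_getD, ih hb, List.map_append, List.sum_append]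

theorem pairCount_append {q : ℕ → ℕ → Prop} {a b : List ℕ} (h : a.Pairwise fun x y => ¬ q x y) :
    pairCount q (a ++ b) = (a.map fun x => b.countP (q x)).sum + pairCount q b := by
  induction a with
  | nil => simp
  | cons x a ih =>
    rw [List.pairwise_cons] at h
    have : a.countP (q x) = 0 := by simpa using h.1
    rw [List.cons_append, pairCount, ih h.2, List.countP_append, this]
    simp [add_assoc]

theorem sum_map_ite (p : ℕ → Prop) (L : List ℕ) :
    (L.map fun y => if p y then 1 else 0).sum = L.countP p := by
  induction L with
  | nil => simp
  | cons x L ih => by_cases h : p x <;> simp [h, ih, add_comm]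

theorem card_inversions (q : ℕ → ℕ → Prop) {μ L : List ℕ} (hL : L.length = μ.sum)
    (hrow : ∀ i j j', j < j' → j' < μ.getD i 0 → ¬ q (entry μ L i j) (entry μ L i j')) :
    ((cellsOf μ ×ˢ cellsOf μ).filter fun pq => pq.1.1 < pq.2.1 ∧
      q (entry μ L pq.1.1 pq.1.2) (entry μ L pq.2.1 pq.2.2)).card = pairCount q L := by
  rw [Finset.card_filter, Finset.sum_product]
  induction μ generalizing L with
  | nil =>
    obtain rfl : L = [] := by simpa using hL
    simp [cellsOf, pairCount]
  | cons k μ ih =>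
    obtain ⟨a, b, rfl, rfl, hb⟩ := exists_append_of_length (hL.trans List.sum_cons)
    have ha : a.Pairwise fun x y => ¬ q x y := by
      rw [List.pairwise_iff_getElem]
      intro i j hi hj hij
      have := hrow 0 i j hij (by simpa using hj)
      simpa [entry_cons_zero, List.getElem?_append, hi, hj] using this
    simp only [sum_cellsOf_cons, entry_cons_zero, entry_cons_succ, List.drop_left]
    have hcross (x : ℕ) : ∑ c ∈ cellsOf μ, (if q x (entry μ b c.1 c.2) then 1 else 0) =
        b.countP (q x) := by
      rw [sum_cellsOf_entry (fun y => if q x y then 1 else 0) hb, sum_map_ite]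
    have hih := ih hb fun i j j' h h' => by
      simpa only [entry_cons_succ, List.drop_left] using hrow (i + 1) j j' h (by simpa using h')
    rw [pairCount_append ha, ← hih, ← sum_range_getD (fun x => b.countP (q x)) a b]
    simp [hcross]

theorem isTab_row {A : Finset ℕ} {r : ℕ → ℕ → Prop} (H : IsShortUIO A r) {μ L : List ℕ}
    (hT : IsTab r μ L) {i j j' : ℕ} (h : j < j') (h' : j' < μ.getD i 0) :
    r (entry μ L i j) (entry μ L i j') := by
  have hi : i < μ.length := by
    by_contra hi
    rw [List.getD_eq_default _ _ (not_lt.1 hi)] at h'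
    omega
  induction j', h using Nat.le_induction with
  | base => exact hT.1 i j hi h'
  | succ m _ ih => exact H.trans (ih (by omega)) (hT.1 i m hi h')

theorem entry_mem {μ L : List ℕ} (hL : L.length = μ.sum) {i j : ℕ} (h : j < μ.getD i 0) :
    entry μ L i j ∈ L := by
  induction μ generalizing L i with
  | nil => simp at h
  | cons k μ ih =>
    obtain ⟨a, b, rfl, rfl, hb⟩ := exists_append_of_length (hL.trans List.sum_cons)
    rcases i with _ | i
    · have : j < a.length := by simpa using h
      rw [entry_cons_zero, List.getD_append _ _ _ _ this, List.getD_eq_getElem _ _ this]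
      simp
    · rw [entry_cons_succ, List.drop_left]
      exact List.mem_append_right _ (ih hb (by simpa using h))

theorem pairCount_congr {p q : ℕ → ℕ → Prop} {L : List ℕ}
    (h : ∀ x ∈ L, ∀ y ∈ L, (p x y ↔ q x y)) : pairCount p L = pairCount q L := by
  induction L with
  | nil => rfl
  | cons x L ih =>
    rw [pairCount, pairCount, ih fun a ha b hb => h a (by simp [ha]) b (by simp [hb])]
    congr 1
    exact List.countP_congr fun y hy => by simp [h x (by simp) y (by simp [hy])]

theorem isTab_congr {r s : ℕ → ℕ → Prop} {μ L : List ℕ} (hL : L.length = μ.sum)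
    (hμ : ∀ i, i + 1 < μ.length → μ.getD (i + 1) 0 ≤ μ.getD i 0)
    (h : ∀ x ∈ L, ∀ y ∈ L, (r x y ↔ s x y)) : IsTab r μ L ↔ IsTab s μ L := by
  unfold IsTab
  refine and_congr (forall₄_congr fun i j _ hj => ?_) (forall₄_congr fun i j hi hj => not_congr ?_)
  · exact h _ (entry_mem hL (by omega)) _ (entry_mem hL hj)
  · exact h _ (entry_mem hL hj) _ (entry_mem hL (hj.trans_le (hμ i hi)))

end IsShortUIO

namespace DyckPath

open IsShortUIO Polynomial

variable {n : ℕ}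

/-- The order `P(d)` restricted to `{1, …, n}`. -/
def rel (D : DyckPath n) (x y : ℕ) : Prop :=
  x ∈ Finset.Icc 1 n ∧ y ∈ Finset.Icc 1 n ∧ D.prec x y

theorem isShortUIO_rel (D : DyckPath n) (h3 : D.BounceThree) :
    IsShortUIO (Finset.Icc 1 n) D.rel where
  mem_left h := h.1
  mem_right h := h.2.1
  lt {x y} h := by
    have hx := Finset.mem_Icc.1 h.1
    exact (D.ge_self x hx.1 hx.2).trans_lt h.2.2.2
  left {x x' y} h hx hxx' := by
    have hx1 := Finset.mem_Icc.1 hx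
    have hx' := Finset.mem_Icc.1 h.1
    exact ⟨hx, h.2.1, hxx'.trans_lt h.2.2.1, (D.mono x x' hx1.1 hxx' hx'.2).trans_lt h.2.2.2⟩
  right h hy hyy' := ⟨h.1, hy, h.2.2.1, h.2.2.2.trans_le hyy'⟩
  no_four {w x y z} hwx hxy hyz := by
    obtain ⟨h0, h1, h2⟩ := h3
    have hw := Finset.mem_Icc.1 hwx.1
    have hx := Finset.mem_Icc.1 hxy.1
    have hy := Finset.mem_Icc.1 hyz.1
    have hz := Finset.mem_Icc.1 hyz.2.1
    have hwx := hwx.2.2.2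
    have hxy := hxy.2.2.2
    have hyz := hyz.2.2.2
    have e1 := D.mono 1 w le_rfl hw.1 hw.2
    have e2 := D.mono (D.m0 + 1) x (by omega) (lt_of_le_of_lt e1 hwx) hx.2
    have e3 := D.mono (D.m1 + 1) y (by omega) (lt_of_le_of_lt e2 hxy) hy.2
    have e4 : D.d (D.m1 + 1) = n := h2
    omega

theorem perm_iff {L : List ℕ} :
    L.Perm ((List.range n).map (· + 1)) ↔ L.Nodup ∧ L.toFinset = Finset.Icc 1 n := by
  have hnd : ((List.range n).map (· + 1)).Nodup :=
    List.nodup_range.map fun _ _ h => by simpa using h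
  have hfs : ((List.range n).map (· + 1)).toFinset = Finset.Icc 1 n := by
    ext x
    simp only [List.mem_toFinset, List.mem_map, List.mem_range, Finset.mem_Icc]
    exact ⟨by rintro ⟨a, ha, rfl⟩; omega, fun h => ⟨x - 1, by omega, by omega⟩⟩
  refine ⟨fun h => ⟨h.nodup_iff.2 hnd, by rw [List.toFinset_eq_of_perm _ _ h, hfs]⟩, fun h => ?_⟩
  exact List.perm_of_nodup_nodup_toFinset_eq h.1 hnd (h.2.trans hfs.symm)

theorem B_eq_zero (D : DyckPath n) {μ : List ℕ} (hμ : μ.sum ≠ n) : D.B μ = 0 := by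
  rw [B, ptabs, Finset.filter_eq_empty_iff.2 fun L _ h => hμ h.2.1, Finset.sum_empty]

theorem B_eq (D : DyckPath n) (h3 : D.BounceThree) {μ : List ℕ} (hsum : μ.sum = n)
    (hμ : ∀ i, i + 1 < μ.length → μ.getD (i + 1) 0 ≤ μ.getD i 0) :
    D.B μ = tabSum (Finset.Icc 1 n) D.rel μ delta (Finset.Icc 1 n) := by
  have H := D.isShortUIO_rel h3
  have hmem {L : List ℕ} (hL : L.toFinset = Finset.Icc 1 n) {x : ℕ} (hx : x ∈ L) :
      x ∈ Finset.Icc 1 n := hL ▸ List.mem_toFinset.2 hx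
  have hrel {L : List ℕ} (hL : L.toFinset = Finset.Icc 1 n) :
      ∀ x ∈ L, ∀ y ∈ L, (D.prec x y ↔ D.rel x y) := fun x hx y hy =>
    ⟨fun h => ⟨hmem hL hx, hmem hL hy, h⟩, fun h => h.2.2⟩
  have hlen {L : List ℕ} (hL : L.Nodup ∧ L.toFinset = Finset.Icc 1 n) : L.length = μ.sum := by
    rw [← List.toFinset_card_of_nodup hL.1, hL.2, hsum, Nat.card_Icc, Nat.add_sub_cancel]
  rw [tabSum_delta, B]
  refine Finset.sum_congr ?_ fun L hL => ?_
  · ext L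
    rw [ptabs, Finset.mem_filter, Finset.mem_filter, List.mem_toFinset, List.mem_permutations,
      mem_words, perm_iff]
    constructor
    · rintro ⟨hL, -, -, hT⟩
      exact ⟨⟨hlen hL, fun _ => hmem hL.2⟩, (isTab_congr (hlen hL) hμ (hrel hL.2)).1 hT, hL⟩
    · rintro ⟨-, hT, hL⟩
      exact ⟨hL, perm_iff.2 hL, hsum, (isTab_congr (hlen hL) hμ (hrel hL.2)).2 hT⟩
  · obtain ⟨-, hT, hL'⟩ := Finset.mem_filter.1 hL
    have hinv : D.invNum μ L = pairCount (Inverts D.prec) L := by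
      rw [← card_inversions (Inverts D.prec) (hlen hL') fun i j j' h h' hq =>
        hq.2.1 (H.isTab_row hT h h').2.2]
      exact congrArg Finset.card (Finset.filter_congr fun _ _ => Iff.rfl)
    rw [hinv, pairCount_congr fun x hx y hy => ?_]
    rw [Inverts, Inverts, hrel hL'.2 x hx y hy, hrel hL'.2 y hy x hx]

theorem shape_antitone (l j m i : ℕ) :
    (shape l j m).getD (i + 1) 0 ≤ (shape l j m).getD i 0 := by
  simp only [shape, List.getD_eq_getElem?_getD, List.getElem?_append, List.getElem?_replicate,
    List.length_append, List.length_replicate]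
  split_ifs <;> simp <;> omega

theorem sum_shape (l j m : ℕ) : (shape l j m).sum = 3 * l + 2 * j + m := by
  simp [shape]
  ring

theorem B_shape (D : DyckPath n) (h3 : D.BounceThree) (l j m : ℕ) (h : 3 * l + 2 * j + m = n) :
    D.B (shape l j m) = (e3 (Finset.Icc 1 n) D.rel ^ l * tabSum (Finset.Icc 1 n) D.rel
      (shape 0 j m)) delta (Finset.Icc 1 n) := by
  rw [D.B_eq h3 ((sum_shape l j m).trans h) fun i _ => shape_antitone l j m i,
    ← (D.isShortUIO_rel h3).tabSum_threes]
  · simp [shape]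
  · rcases j with _ | j <;> rcases m with _ | m <;> simp [shape, List.replicate_succ]

theorem B_shape_one (D : DyckPath n) (h3 : D.BounceThree) (l m : ℕ) (h : 3 * l + 2 + m = n) :
    D.B (shape l 1 m) = (e3 (Finset.Icc 1 n) D.rel ^ l * hook (Finset.Icc 1 n) D.rel m)
      delta (Finset.Icc 1 n) := by
  rw [D.B_shape h3 l 1 m h, ← (D.isShortUIO_rel h3).tabSum_two]
  simp [shape]

theorem B_shape_two (D : DyckPath n) (h3 : D.BounceThree) (l m : ℕ) (h : 3 * l + 4 + m = n) :
    D.B (shape l 2 m) = (e3 (Finset.Icc 1 n) D.rel ^ l * hook22 (Finset.Icc 1 n) D.rel m)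
      delta (Finset.Icc 1 n) := by
  rw [D.B_shape h3 l 2 m h, ← (D.isShortUIO_rel h3).tabSum_two_two]
  simp [shape, List.replicate_succ]

theorem B_shape_zero (D : DyckPath n) (h3 : D.BounceThree) (l m : ℕ) (hn : 3 * l + m = n) :
    D.B (shape l 0 m) = (e3 (Finset.Icc 1 n) D.rel ^ l * h (Finset.Icc 1 n) D.rel m)
      delta (Finset.Icc 1 n) := by
  rw [D.B_shape h3 l 0 m hn, ← tabSum_ones]
  simp [shape]

theorem coeff_nonneg_of_isPos {F : Module.End ℤ[X] (Finset ℕ → ℤ[X])} (hF : IsPos F)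
    (S : Finset ℕ) (k : ℕ) : 0 ≤ (F delta S).coeff k := by
  refine hF delta (fun S k => ?_) S k
  rw [delta]
  split_ifs
  · rw [Polynomial.coeff_one]
    split_ifs <;> simp
  · simp

end DyckPath

/-- **Theorem `e_{(n-2l-1,l+1,l)}`.** For a Dyck path of bounce number three and
`0 ≤ l ≤ min {a,b,c}`, the coefficient of `e_{(n-2l-1,l+1,l)}`, namely
`B_{3^l 2 1^{n-3l-2}} - B_{3^l 2^2 1^{n-3l-4}} + B_{3^{l+1} 2 1^{n-3l-5}} - B_{3^{l+1} 1^{n-3l-3}}`,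
lies in `ℕ[q]`. -/
theorem coeff_e_n_sub_2l_sub_one_nonneg
    (n : ℕ) (D : DyckPath n) (h3 : D.BounceThree)
    (l : ℕ) (hl : l ≤ min (n - D.m1) (min (D.m1 - D.m0) D.m0)) :
    ∀ k : ℕ,
      0 ≤ (D.B (shape l 1 (n - 3 * l - 2)) - D.B (shape l 2 (n - 3 * l - 4))
            + D.B (shape (l + 1) 1 (n - 3 * l - 5))
            - D.B (shape (l + 1) 0 (n - 3 * l - 3))).coeff k := by
  intro k
  have H := D.isShortUIO_rel h3
  have hpow : IsShortUIO.IsPos (IsShortUIO.e3 (Finset.Icc 1 n) D.rel ^ l) :=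
    IsShortUIO.IsPos.pow IsShortUIO.isPos_e3 l
  have hzero : ∀ {a b c : ℕ}, 3 * a + 2 * b + c ≠ n → D.B (shape a b c) = 0 := fun {a b c} h =>
    D.B_eq_zero (by rwa [DyckPath.sum_shape])
  obtain hn | hn | hn | hn | ⟨m, hn⟩ : n < 3 * l + 2 ∨ n = 3 * l + 2 ∨ n = 3 * l + 3 ∨
      n = 3 * l + 4 ∨ ∃ m, n = 3 * l + (m + 5) := by
    by_cases h : n < 3 * l + 5
    · omega
    · exact .inr (.inr (.inr (.inr ⟨n - 3 * l - 5, by omega⟩)))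
  · rw [hzero (by omega), hzero (by omega), hzero (by omega), hzero (by omega)]
    simp
  · rw [D.B_shape_one h3 _ (n - 3 * l - 2) (by omega), hzero (a := l) (by omega),
      hzero (a := l + 1) (by omega), hzero (a := l + 1) (by omega),
      show n - 3 * l - 2 = 0 by omega, IsShortUIO.hook_zero]
    simpa using DyckPath.coeff_nonneg_of_isPos (hpow.mul IsShortUIO.isPos_e2) (Finset.Icc 1 n) k
  · have key := DyckPath.coeff_nonneg_of_isPos (hpow.mul H.isPos_three) (Finset.Icc 1 n) k
    rw [D.B_shape_one h3 _ (n - 3 * l - 2) (by omega), hzero (a := l) (by omega),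
      hzero (a := l + 1) (by omega), D.B_shape_zero h3 _ (n - 3 * l - 3) (by omega),
      show n - 3 * l - 2 = 1 by omega, show n - 3 * l - 3 = 0 by omega, IsShortUIO.h_zero]
    simpa [mul_sub, pow_succ] using key
  · have key := DyckPath.coeff_nonneg_of_isPos (hpow.mul H.isPos_four) (Finset.Icc 1 n) k
    rw [D.B_shape_one h3 _ (n - 3 * l - 2) (by omega),
      D.B_shape_two h3 _ (n - 3 * l - 4) (by omega),
      hzero (by omega), D.B_shape_zero h3 _ (n - 3 * l - 3) (by omega),
      show n - 3 * l - 2 = 2 by omega, show n - 3 * l - 3 = 1 by omega,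
      show n - 3 * l - 4 = 0 by omega]
    simpa [mul_sub, pow_succ, mul_assoc] using key
  · have key := DyckPath.coeff_nonneg_of_isPos (hpow.mul (H.isPos_add_five m)) (Finset.Icc 1 n) k
    rw [D.B_shape_one h3 _ (n - 3 * l - 2) (by omega),
      D.B_shape_two h3 _ (n - 3 * l - 4) (by omega),
      D.B_shape_one h3 _ (n - 3 * l - 5) (by omega), D.B_shape_zero h3 _ (n - 3 * l - 3) (by omega),
      show n - 3 * l - 2 = m + 3 by omega, show n - 3 * l - 3 = m + 2 by omega,
      show n - 3 * l - 4 = m + 1 by omega, show n - 3 * l - 5 = m by omega]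
    simpa [mul_sub, mul_add, pow_succ, mul_assoc] using key
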